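/- arXiv:1902.10986 — 5 statements merged into one kernel-verified Lean document; each statement's English description precedes it below -/
import Mathlib

section
/- Let B be a basis of a Banach space X over 𝔽 and let w be a weight. If B is C_a-w-almost-greedy, then B is C_q-quasi-greedy with C_q ≤ C_a, C_sd-w-disjoint-super-democratic with C_sd ≤ C_a, and C_s-w-super-democratic with C_s ≤ 2κC_a, where κ = 1 if 𝔽 = ℝ and κ = 2 if 𝔽 = ℂ. -/
open scoped BigOperators NNReal

noncomputable section

/-- A semi-normalized strong Markushevich basis of a space `X` over `𝕜`. -/
structure MBasis (𝕜 : Type*) [RCLike 𝕜] (X : Type*) [NormedAddCommGroup X]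
    [NormedSpace 𝕜 X] where
  /-- the basis vectors -/
  e : ℕ → X
  /-- the biorthogonal functionals -/
  f : ℕ → X →L[𝕜] 𝕜
  /-- a positive lower bound for the norms: `c₁ = inf_n min (‖e n‖, ‖f n‖)` -/
  c₁ : ℝ
  /-- an upper bound for the norms: `c₂ = sup_n max (‖e n‖, ‖f n‖)` -/
  c₂ : ℝ
  c₁_pos : 0 < c₁
  c₁_le_e : ∀ n, c₁ ≤ ‖e n‖
  c₁_le_f : ∀ n, c₁ ≤ ‖f n‖
  e_le_c₂ : ∀ n, ‖e n‖ ≤ c₂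
  f_le_c₂ : ∀ n, ‖f n‖ ≤ c₂
  biorth : ∀ j i, f j (e i) = if j = i then 1 else 0
  dense_span : closure (Submodule.span 𝕜 (Set.range e) : Set X) = Set.univ
  total : ∀ x : X, (∀ j, f j x = 0) → x = 0
  strong : ∀ A : Set ℕ,
    closure (Submodule.span 𝕜 (e '' A) : Set X) = {x : X | ∀ j ∉ A, f j x = 0}

namespace MBasis

variable {𝕜 : Type*} [RCLike 𝕜] {X : Type*} [NormedAddCommGroup X] [NormedSpace 𝕜 X]

/-- A sign is a family of scalars of modulus one. -/
def IsSign (ε : ℕ → 𝕜) : Prop := ∀ n, ‖ε n‖ = 1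

/-- `w(A) = Σ_{i ∈ A} w i` for a weight `w`. -/
def wSum (w : ℕ → ℝ) (A : Finset ℕ) : ℝ := ∑ i ∈ A, w i

/-- The projection `P_A x = Σ_{n ∈ A} eₙ*(x) eₙ`. -/
def proj (b : MBasis 𝕜 X) (A : Finset ℕ) (x : X) : X := ∑ n ∈ A, b.f n x • b.e n

/-- `1_{εA} = Σ_{n ∈ A} εₙ eₙ`. -/
def indic (b : MBasis 𝕜 X) (ε : ℕ → 𝕜) (A : Finset ℕ) : X := ∑ n ∈ A, ε n • b.e n

/-- `Λ` is a greedy set of `x`: coefficients inside dominate those outside. -/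
def IsGreedySet (b : MBasis 𝕜 X) (x : X) (Λ : Finset ℕ) : Prop :=
  ∀ n ∈ Λ, ∀ k, k ∉ Λ → ‖b.f k x‖ ≤ ‖b.f n x‖

/-- `B` is a Schauder basis with basis constant (at most) `K`. -/
def SchauderConst (b : MBasis 𝕜 X) (K : ℝ) : Prop :=
  ∀ m : ℕ, ∀ x : X, ‖∑ j ∈ Finset.range m, b.f j x • b.e j‖ ≤ K * ‖x‖

/-- `B` is `C`-quasi-greedy. -/
def QuasiGreedy (b : MBasis 𝕜 X) (C : ℝ) : Prop :=
  ∀ x : X, ∀ Λ : Finset ℕ, b.IsGreedySet x Λ → ‖x - b.proj Λ x‖ ≤ C * ‖x‖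

/-- `B` is `C`-`w`-almost-greedy. -/
def WAlmostGreedy (b : MBasis 𝕜 X) (w : ℕ → ℝ) (C : ℝ) : Prop :=
  ∀ x : X, ∀ Λ : Finset ℕ, b.IsGreedySet x Λ →
    ∀ A : Finset ℕ, wSum w A ≤ wSum w Λ →
      ‖x - b.proj Λ x‖ ≤ C * ‖x - b.proj A x‖

/-- `B` is `C`-`w`-super-democratic. -/
def WSuperDemocratic (b : MBasis 𝕜 X) (w : ℕ → ℝ) (C : ℝ) : Prop :=
  ∀ A B : Finset ℕ, wSum w A ≤ wSum w B →
    ∀ ε ε' : ℕ → 𝕜, IsSign ε → IsSign ε' →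
      ‖b.indic ε A‖ ≤ C * ‖b.indic ε' B‖

/-- `B` is `C`-`w`-disjoint-super-democratic. -/
def WDisjSuperDemocratic (b : MBasis 𝕜 X) (w : ℕ → ℝ) (C : ℝ) : Prop :=
  ∀ A B : Finset ℕ, Disjoint A B → wSum w A ≤ wSum w B →
    ∀ ε ε' : ℕ → 𝕜, IsSign ε → IsSign ε' →
      ‖b.indic ε A‖ ≤ C * ‖b.indic ε' B‖

/-- `B` is `C`-`w`-democratic. -/
def WDemocratic (b : MBasis 𝕜 X) (w : ℕ → ℝ) (C : ℝ) : Prop :=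
  ∀ A B : Finset ℕ, wSum w A ≤ wSum w B →
    ‖∑ n ∈ A, b.e n‖ ≤ C * ‖∑ n ∈ B, b.e n‖

/-- `B` is `C`-`w`-semi-greedy: the Chebyshev greedy approximant supported on any greedy
set `Λ` does as well, up to the constant `C`, as any approximant supported on a set `A`
with `w(A) ≤ w(Λ)`. -/
def WSemiGreedy (b : MBasis 𝕜 X) (w : ℕ → ℝ) (C : ℝ) : Prop :=
  ∀ x : X, ∀ Λ : Finset ℕ, b.IsGreedySet x Λ →
    ∀ A : Finset ℕ, wSum w A ≤ wSum w Λ → ∀ a : ℕ → 𝕜,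
      ∃ z ∈ Submodule.span 𝕜 (b.e '' (Λ : Set ℕ)),
        ‖x - z‖ ≤ C * ‖x - ∑ n ∈ A, a n • b.e n‖

/-- `B` is `C`-super-democratic (unweighted). -/
def SuperDemocratic (b : MBasis 𝕜 X) (C : ℝ) : Prop :=
  ∀ A B : Finset ℕ, A.card ≤ B.card →
    ∀ ε ε' : ℕ → 𝕜, IsSign ε → IsSign ε' →
      ‖b.indic ε A‖ ≤ C * ‖b.indic ε' B‖

/-- `B` is `C`-disjoint-super-democratic (unweighted). -/
def DisjSuperDemocratic (b : MBasis 𝕜 X) (C : ℝ) : Prop :=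
  ∀ A B : Finset ℕ, Disjoint A B → A.card ≤ B.card →
    ∀ ε ε' : ℕ → 𝕜, IsSign ε → IsSign ε' →
      ‖b.indic ε A‖ ≤ C * ‖b.indic ε' B‖

/-- `B` is `C`-semi-greedy (unweighted). -/
def SemiGreedy (b : MBasis 𝕜 X) (C : ℝ) : Prop :=
  ∀ x : X, ∀ Λ : Finset ℕ, b.IsGreedySet x Λ →
    ∀ A : Finset ℕ, A.card ≤ Λ.card → ∀ a : ℕ → 𝕜,
      ∃ z ∈ Submodule.span 𝕜 (b.e '' (Λ : Set ℕ)),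
        ‖x - z‖ ≤ C * ‖x - ∑ n ∈ A, a n • b.e n‖

/-- `B` is `ρ`-admissible. -/
def RhoAdmissible (b : MBasis 𝕜 X) (ρ : ℝ) : Prop :=
  ∀ A : Finset ℕ, ∃ n₀ : ℕ, ∀ B : Finset ℕ, (∀ n ∈ B, n₀ ≤ n) → B.card ≤ A.card →
    ∀ α : ℕ → 𝕜, ‖∑ n ∈ A, α n • b.e n‖ ≤ ρ * ‖∑ n ∈ A ∪ B, α n • b.e n‖

/-- `B` has the `C`-Property (C). -/
def PropertyC (b : MBasis 𝕜 X) (C : ℝ) : Prop :=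
  ∀ x : X, ∀ G : Finset ℕ, b.IsGreedySet x G → ∀ hG : G.Nonempty,
    ∀ ε : ℕ → 𝕜, IsSign ε →
      (G.inf' hG fun j => ‖b.f j x‖) * ‖b.indic ε G‖ ≤ C * ‖x‖

/-- `B` is equivalent to the canonical basis of `c₀`. -/
def EquivC0 (b : MBasis 𝕜 X) : Prop :=
  ∃ c C : ℝ, 0 < c ∧ c ≤ C ∧ ∀ A : Finset ℕ, ∀ a : ℕ → 𝕜,
    c * (↑(A.sup fun n => ‖a n‖₊) : ℝ) ≤ ‖∑ n ∈ A, a n • b.e n‖ ∧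
      ‖∑ n ∈ A, a n • b.e n‖ ≤ C * (↑(A.sup fun n => ‖a n‖₊) : ℝ)

/-- The subsequence `(e (σ k))_k` is equivalent to the canonical basis of `c₀`. -/
def SubseqEquivC0 (b : MBasis 𝕜 X) (σ : ℕ → ℕ) : Prop :=
  ∃ c C : ℝ, 0 < c ∧ c ≤ C ∧ ∀ F : Finset ℕ, ∀ a : ℕ → 𝕜,
    c * (↑(F.sup fun k => ‖a k‖₊) : ℝ) ≤ ‖∑ k ∈ F, a k • b.e (σ k)‖ ∧
      ‖∑ k ∈ F, a k • b.e (σ k)‖ ≤ C * (↑(F.sup fun k => ‖a k‖₊) : ℝ)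

end MBasis

open Classical in
/-- `κ = 1` if `𝕜 = ℝ` and `κ = 2` if `𝕜 = ℂ` (detected by whether `I = 0`). -/
noncomputable def kappa (𝕜 : Type*) [RCLike 𝕜] : ℝ :=
  if (RCLike.I : 𝕜) = 0 then 1 else 2


variable {𝕜 : Type*} [RCLike 𝕜] {X : Type*} [NormedAddCommGroup X] [NormedSpace 𝕜 X]
  [CompleteSpace X]

open MBasis

theorem aux_convex {𝕜 : Type*} [RCLike 𝕜] {X : Type*} [NormedAddCommGroup X] [NormedSpace 𝕜 X]
    (u : ℕ → X) (M : ℝ) (a : ℕ → ℝ) (S : Finset ℕ) :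
    ∀ v : X, (∀ n ∈ S, 0 ≤ a n ∧ a n ≤ 1) →
    (∀ D ⊆ S, ‖v + ∑ n ∈ D, u n‖ ≤ M) → ‖v + ∑ n ∈ S, (a n : 𝕜) • u n‖ ≤ M := by
  classical
  induction S using Finset.induction_on with
  | empty => intro v _ h; simpa using h ∅ (by simp)
  | insert s S hs ih =>
    intro v ha h
    have ha' : ∀ n ∈ S, 0 ≤ a n ∧ a n ≤ 1 := fun n hn => ha n (Finset.mem_insert_of_mem hn)
    have h1 := ih v ha' (fun D hD => h D (hD.trans (Finset.subset_insert _ _)))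
    have h2 := ih (v + u s) ha' (fun D hD => by
      have := h (insert s D) (Finset.insert_subset_insert _ hD)
      rwa [Finset.sum_insert (fun hh => hs (hD hh)), ← add_assoc] at this)
    obtain ⟨h0, h01⟩ := ha s (Finset.mem_insert_self _ _)
    rw [Finset.sum_insert hs]
    set T := ∑ n ∈ S, (a n : 𝕜) • u n
    have e : v + ((a s : 𝕜) • u s + T) =
        ((1 - a s : ℝ) : 𝕜) • (v + T) + (a s : 𝕜) • (v + u s + T) := by
      push_cast
      module
    rw [e]
    refine (norm_add_le _ _).trans ?_
    rw [norm_smul, norm_smul, RCLike.norm_ofReal, RCLike.norm_ofReal, abs_of_nonneg h0,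
      abs_of_nonneg (sub_nonneg.2 h01)]
    nlinarith

theorem aux_key {𝕜 : Type*} [RCLike 𝕜] {X : Type*} [NormedAddCommGroup X] [NormedSpace 𝕜 X]
    (b : MBasis 𝕜 X) (w : ℕ → ℝ) (Ca : ℝ) (h : b.WAlmostGreedy w Ca)
    (A B D : Finset ℕ) (hAB : Disjoint A B) (hD : D ⊆ B) (hw : wSum w A ≤ wSum w (B \ D))
    (ε ε' : ℕ → 𝕜) (hε : IsSign ε) (hε' : IsSign ε') :
    ‖b.indic ε A + b.indic ε' D‖ ≤ Ca * ‖b.indic ε' B‖ := by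
  have hf : ∀ n, b.f n (b.indic ε A + b.indic ε' B) =
      (if n ∈ A then ε n else 0) + (if n ∈ B then ε' n else 0) := by
    intro n
    simp [indic, b.biorth]
  have hfA : ∀ n ∈ A, b.f n (b.indic ε A + b.indic ε' B) = ε n := by
    intro n hn
    rw [hf, if_pos hn, if_neg (Finset.disjoint_left.1 hAB hn), add_zero]
  have hfB : ∀ n ∈ B, b.f n (b.indic ε A + b.indic ε' B) = ε' n := by
    intro n hn
    rw [hf, if_pos hn, if_neg (Finset.disjoint_right.1 hAB hn), zero_add]
  have hg : b.IsGreedySet (b.indic ε A + b.indic ε' B) (B \ D) := by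
    intro n hn k _
    rw [hfB n (Finset.mem_sdiff.1 hn).1, hε' n]
    by_cases hkA : k ∈ A
    · rw [hfA k hkA, hε k]
    · by_cases hkB : k ∈ B
      · rw [hfB k hkB, hε' k]
      · rw [hf, if_neg hkA, if_neg hkB]; simp
  have key := h _ _ hg A hw
  have e1 : b.proj (B \ D) (b.indic ε A + b.indic ε' B) = b.indic ε' (B \ D) := by
    unfold proj
    exact Finset.sum_congr rfl fun n hn => by rw [hfB n (Finset.mem_sdiff.1 hn).1]
  have e2 : b.proj A (b.indic ε A + b.indic ε' B) = b.indic ε A := by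
    unfold proj
    exact Finset.sum_congr rfl fun n hn => by rw [hfA n hn]
  have e3 : b.indic ε' B = b.indic ε' (B \ D) + b.indic ε' D :=
    (Finset.sum_sdiff hD).symm
  rw [e1, e2, add_sub_cancel_left] at key
  have e4 : b.indic ε A + b.indic ε' B - b.indic ε' (B \ D) = b.indic ε A + b.indic ε' D := by
    rw [e3]; abel
  rwa [e4] at key

/-- If `B` is `C_a`-`w`-almost-greedy, then `B` is `C_a`-quasi-greedy,
`C_a`-`w`-disjoint-super-democratic and `2κC_a`-`w`-super-democratic. -/
theorem stmt0 (b : MBasis 𝕜 X) (w : ℕ → ℝ) (hw : ∀ n, 0 < w n) (Ca : ℝ)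
    (h : b.WAlmostGreedy w Ca) :
    b.QuasiGreedy Ca ∧ b.WDisjSuperDemocratic w Ca ∧
      b.WSuperDemocratic w (2 * kappa 𝕜 * Ca) := by
  classical
  refine ⟨?_, ?_, ?_⟩
  · intro x Λ hΛ
    have := h x Λ hΛ ∅ (by
      simp only [wSum, Finset.sum_empty]
      exact Finset.sum_nonneg fun i _ => (hw i).le)
    simpa [proj] using this
  · intro A B hAB hwAB ε ε' hε hε'
    have := aux_key b w Ca h A B ∅ hAB (by simp) (by simpa using hwAB) ε ε' hε hε'
    simpa [indic] using this
  · intro A B hwAB ε ε' hε hε'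
    set M := Ca * ‖b.indic ε' B‖ with hM
    set S := A ∩ B with hS
    have hw1 : wSum w (A \ B) ≤ wSum w (B \ A) := by
      have h1 : wSum w (A ∩ B) + wSum w (A \ B) = wSum w A := Finset.sum_inter_add_sum_sdiff A B w
      have h2 : wSum w (B ∩ A) + wSum w (B \ A) = wSum w B := Finset.sum_inter_add_sum_sdiff B A w
      rw [Finset.inter_comm] at h2
      linarith
    have hmono : ∀ D ⊆ S, wSum w (B \ A) ≤ wSum w (B \ D) := fun D hD =>
      Finset.sum_le_sum_of_subset_of_nonneg
        (Finset.sdiff_subset_sdiff le_rfl (hD.trans Finset.inter_subset_left))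
        fun i _ _ => (hw i).le
    have hv : ∀ D ⊆ S, ‖b.indic ε (A \ B) + ∑ n ∈ D, ε' n • b.e n‖ ≤ M := fun D hD =>
      aux_key b w Ca h (A \ B) B D Finset.sdiff_disjoint (hD.trans Finset.inter_subset_right)
        (hw1.trans (hmono D hD)) ε ε' hε hε'
    have h0 : ∀ D ⊆ S, ‖(0 : X) + ∑ n ∈ D, ε' n • b.e n‖ ≤ M := fun D hD => by
      have := aux_key b w Ca h ∅ B D (by simp) (hD.trans Finset.inter_subset_right)
        (by simp only [wSum, Finset.sum_empty]
            exact Finset.sum_nonneg fun i _ => (hw i).le) ε ε' hε hε'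
      simpa [indic, hM] using this
    set η : ℕ → 𝕜 := fun n => ε n / ε' n with hη
    have hηn : ∀ n, ‖η n‖ = 1 := fun n => by simp [hη, hε n, hε' n]
    have hre : ∀ n, |RCLike.re (η n)| ≤ 1 := fun n => (RCLike.abs_re_le_norm _).trans (hηn n).le
    have him : ∀ n, |RCLike.im (η n)| ≤ 1 := fun n => (RCLike.abs_im_le_norm _).trans (hηn n).le
    have c1 := aux_convex (𝕜 := 𝕜) (fun n => ε' n • b.e n) M
      (fun n => max (RCLike.re (η n)) 0) S _
      (fun n _ => ⟨le_max_right _ _, max_le (abs_le.1 (hre n)).2 zero_le_one⟩) hv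
    have c2 := aux_convex (𝕜 := 𝕜) (fun n => ε' n • b.e n) M
      (fun n => max (-RCLike.re (η n)) 0) S _
      (fun n _ => ⟨le_max_right _ _, max_le (neg_le.1 (abs_le.1 (hre n)).1) zero_le_one⟩) h0
    have c3 := aux_convex (𝕜 := 𝕜) (fun n => ε' n • b.e n) M
      (fun n => max (RCLike.im (η n)) 0) S _
      (fun n _ => ⟨le_max_right _ _, max_le (abs_le.1 (him n)).2 zero_le_one⟩) h0
    have c4 := aux_convex (𝕜 := 𝕜) (fun n => ε' n • b.e n) M
      (fun n => max (-RCLike.im (η n)) 0) S _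
      (fun n _ => ⟨le_max_right _ _, max_le (neg_le.1 (abs_le.1 (him n)).1) zero_le_one⟩) h0
    have hM0 : 0 ≤ M := (norm_nonneg _).trans c2
    have hA : b.indic ε A = b.indic ε (A \ B) + ∑ n ∈ S, ε n • b.e n := by
      rw [add_comm]
      exact (Finset.sum_inter_add_sum_sdiff A B _).symm
    have hpm : ∀ t : ℝ, t = max t 0 - max (-t) 0 := fun t => (max_zero_sub_max_neg_zero_eq_self t).symm
    have hterm : ∀ n, ε n • b.e n =
        ((max (RCLike.re (η n)) 0 : ℝ) : 𝕜) • (ε' n • b.e n)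
        - ((max (-RCLike.re (η n)) 0 : ℝ) : 𝕜) • (ε' n • b.e n)
        + (RCLike.I : 𝕜) • (((max (RCLike.im (η n)) 0 : ℝ) : 𝕜) • (ε' n • b.e n)
        - ((max (-RCLike.im (η n)) 0 : ℝ) : 𝕜) • (ε' n • b.e n)) := by
      intro n
      have hne : ε' n ≠ 0 := by
        intro hh; have := hε' n; rw [hh, norm_zero] at this; exact zero_ne_one this
      rw [← sub_smul, ← sub_smul, ← RCLike.ofReal_sub, ← RCLike.ofReal_sub, ← hpm, ← hpm,
        smul_smul, smul_smul, smul_smul, ← add_smul]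
      congr 1
      have h5 : ε n = η n * ε' n := by simp [hη, hne]
      conv_lhs => rw [h5, ← RCLike.re_add_im (η n)]
      ring
    rw [hA, Finset.sum_congr rfl fun n _ => hterm n, Finset.sum_add_distrib,
      Finset.sum_sub_distrib, ← Finset.smul_sum, Finset.sum_sub_distrib]
    rw [zero_add] at c2 c3 c4
    have hI : 2 * kappa 𝕜 * Ca * ‖b.indic ε' B‖ = 2 * kappa 𝕜 * M := by rw [hM]; ring
    rw [hI, ← add_assoc, ← add_sub_assoc]
    refine (norm_add_le _ _).trans ?_
    have d1 := (norm_sub_le _ _).trans (add_le_add c1 c2)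
    have d2 := (norm_sub_le _ _).trans (add_le_add c3 c4)
    by_cases hI0 : (RCLike.I : 𝕜) = 0
    · rw [kappa, if_pos hI0, hI0, zero_smul, norm_zero]
      linarith
    · rw [kappa, if_neg hI0, norm_smul, RCLike.norm_I_of_ne_zero hI0, one_mul]
      linarith
end
end

section
/- Let B be a basis of a Banach space X over 𝔽 and let w be a weight. If B is C_q-quasi-greedy and C_sd-w-disjoint-super-democratic, then B is C_a-w-almost-greedy with C_a ≤ C_q + 2C_qC_sd. -/
open scoped BigOperators NNReal

noncomputable section

variable {𝕜 : Type*} [RCLike 𝕜] {X : Type*} [NormedAddCommGroup X] [NormedSpace 𝕜 X]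
  [CompleteSpace X]

open MBasis

theorem aux_convex_s1 (b : MBasis 𝕜 X) (A : Finset ℕ) (M : ℝ)
    (hM : ∀ ε : ℕ → 𝕜, IsSign ε → ‖b.indic ε A‖ ≤ M) (S : Finset ℕ) :
    ∀ c : ℕ → 𝕜, (∀ n ∈ S, ‖c n‖ ≤ 1) → (∀ n ∉ S, ‖c n‖ = 1) → ‖b.indic c A‖ ≤ M := by
  classical
  induction S using Finset.induction_on with
  | empty => intro c _ h; exact hM c (fun n => h n (by simp))
  | insert a S ha ih =>
    intro c h1 h2
    obtain ⟨u, hu, hcu⟩ : ∃ u : 𝕜, ‖u‖ = 1 ∧ c a = (‖c a‖ : 𝕜) * u := by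
      by_cases h0 : c a = 0
      · exact ⟨1, by simp, by simp [h0]⟩
      · have hn : (‖c a‖ : 𝕜) ≠ 0 := by simpa using h0
        refine ⟨c a / (‖c a‖ : 𝕜), ?_, ?_⟩
        · simp [h0]
        · field_simp
    set r : ℝ := ‖c a‖ with hr
    have hr0 : 0 ≤ r := norm_nonneg _
    have hr1 : r ≤ 1 := h1 a (by simp)
    have key : ∀ z : 𝕜, ‖z‖ = 1 → ‖b.indic (Function.update c a z) A‖ ≤ M := by
      intro z hz
      apply ih
      · intro n hn
        have : n ≠ a := by rintro rfl; exact ha hn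
        rw [Function.update_of_ne this]
        exact h1 n (by simp [hn])
      · intro n hn
        by_cases hna : n = a
        · subst hna; simpa using hz
        · rw [Function.update_of_ne hna]
          exact h2 n (by simp [hn, hna])
    have e : b.indic c A = (((1 + r) / 2 : ℝ) : 𝕜) • b.indic (Function.update c a u) A
        + (((1 - r) / 2 : ℝ) : 𝕜) • b.indic (Function.update c a (-u)) A := by
      unfold MBasis.indic
      rw [Finset.smul_sum, Finset.smul_sum, ← Finset.sum_add_distrib]
      apply Finset.sum_congr rfl
      intro n _
      rw [smul_smul, smul_smul, ← add_smul]
      congr 1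
      by_cases hna : n = a
      · subst hna
        simp only [Function.update_self]
        rw [hcu]
        push_cast
        ring
      · simp only [Function.update_of_ne hna]
        push_cast
        ring
    rw [e]
    refine (norm_add_le _ _).trans ?_
    rw [norm_smul, norm_smul, RCLike.norm_ofReal, RCLike.norm_ofReal,
      abs_of_nonneg (by linarith), abs_of_nonneg (by linarith)]
    nlinarith [key u hu, key (-u) (by simpa using hu)]

theorem aux_abel (b : MBasis 𝕜 X) (Cq : ℝ) (hq : b.QuasiGreedy Cq) (y : X) (Λ : Finset ℕ)
    (hΛ : b.IsGreedySet y Λ) (v : ℕ → ℝ) (hv1 : ∀ n ∈ Λ, v n ≤ 1)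
    (hanti : ∀ n ∈ Λ, ∀ m ∈ Λ, ‖b.f n y‖ ≤ ‖b.f m y‖ → v m ≤ v n) (S : Finset ℕ) :
    S ⊆ Λ → b.IsGreedySet y (Λ \ S) → ∀ s : ℝ, s ≤ 1 → (∀ n ∈ S, s ≤ v n) →
    ‖∑ n ∈ S, ((v n - s : ℝ) : 𝕜) • (b.f n y • b.e n)‖ ≤ (1 - s) * (2 * Cq * ‖y‖) := by
  classical
  have hD : 0 ≤ Cq * ‖y‖ := (norm_nonneg _).trans (hq y Λ hΛ)
  induction S using Finset.induction_on_max_value (fun n => ‖b.f n y‖) with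
  | empty =>
    intro _ _ s hs _
    simp only [Finset.sum_empty, norm_zero]
    apply mul_nonneg <;> linarith
  | insert m S hm hmax ih =>
    intro hsub hg s hs hsv
    have hmΛ : m ∈ Λ := hsub (by simp)
    have hSΛ : S ⊆ Λ := fun n hn => hsub (by simp [hn])
    have hg' : b.IsGreedySet y (Λ \ S) := by
      intro n hn k hk
      simp only [Finset.mem_sdiff] at hn hk
      by_cases hkΛ : k ∈ Λ
      · have hkS : k ∈ S := by tauto
        by_cases hnm : n = m
        · subst hnm; exact hmax k hkS
        · exact hg n (by simp [hn, hnm]) k (by simp [hkS])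
      · exact hΛ n hn.1 k hkΛ
    have h1 := ih hSΛ hg' (v m) (hv1 m hmΛ)
      (fun n hn => hanti n (hSΛ hn) m hmΛ (hmax n hn))
    have h2 : ‖∑ n ∈ insert m S, b.f n y • b.e n‖ ≤ 2 * Cq * ‖y‖ := by
      have e : ∑ n ∈ insert m S, b.f n y • b.e n
          = (y - b.proj (Λ \ insert m S) y) - (y - b.proj Λ y) := by
        unfold MBasis.proj
        rw [← Finset.sum_sdiff hsub]
        abel
      rw [e]
      refine (norm_sub_le _ _).trans ?_
      linarith [hq y _ hg, hq y _ hΛ]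
    have e : ∑ n ∈ insert m S, ((v n - s : ℝ) : 𝕜) • (b.f n y • b.e n)
        = ((v m - s : ℝ) : 𝕜) • (∑ n ∈ insert m S, b.f n y • b.e n)
          + ∑ n ∈ S, ((v n - v m : ℝ) : 𝕜) • (b.f n y • b.e n) := by
      rw [Finset.smul_sum, Finset.sum_insert hm, Finset.sum_insert hm, add_assoc,
        ← Finset.sum_add_distrib]
      congr 1
      apply Finset.sum_congr rfl
      intro n _
      rw [← add_smul]
      congr 1
      push_cast
      ring
    have h3 : s ≤ v m := hsv m (by simp)
    rw [e]
    refine (norm_add_le _ _).trans ?_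
    rw [norm_smul, RCLike.norm_ofReal, abs_of_nonneg (by linarith)]
    have := mul_le_mul_of_nonneg_left h2 (sub_nonneg.2 h3)
    linarith

theorem aux_trunc (b : MBasis 𝕜 X) (Cq : ℝ) (hq : b.QuasiGreedy Cq) (y : X) (Λ : Finset ℕ)
    (hΛ : b.IsGreedySet y Λ) (t : ℝ) (ht : 0 < t) (h : ∀ n ∈ Λ, t ≤ ‖b.f n y‖) :
    ∃ ε : ℕ → 𝕜, IsSign ε ∧ t * ‖b.indic ε Λ‖ ≤ 2 * Cq * ‖y‖ := by
  classical
  refine ⟨fun n => if b.f n y = 0 then 1 else b.f n y / (‖b.f n y‖ : 𝕜), ?_, ?_⟩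
  · intro n
    by_cases h0 : b.f n y = 0 <;> simp [h0]
  · have hpos : ∀ n ∈ Λ, 0 < ‖b.f n y‖ := fun n hn => ht.trans_le (h n hn)
    have := aux_abel b Cq hq y Λ hΛ (fun n => t / ‖b.f n y‖)
      (fun n hn => (div_le_one (hpos n hn)).2 (h n hn))
      (fun n hn m hm hnm => div_le_div_of_nonneg_left ht.le (hpos n hn) hnm)
      Λ subset_rfl (by intro n hn; simp at hn) 0 zero_le_one
      (fun n hn => (div_pos ht (hpos n hn)).le)
    rw [sub_zero, one_mul] at this
    refine le_trans (le_of_eq ?_) this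
    have ht' : ‖((t : ℝ) : 𝕜)‖ = t := by rw [RCLike.norm_ofReal, abs_of_pos ht]
    conv_lhs => rw [← ht']
    rw [← norm_smul]
    unfold MBasis.indic
    rw [Finset.smul_sum]
    congr 1
    apply Finset.sum_congr rfl
    intro n hn
    have h0 : b.f n y ≠ 0 := norm_pos_iff.1 (hpos n hn)
    beta_reduce
    rw [if_neg h0, smul_smul, smul_smul]
    congr 1
    push_cast
    ring

theorem aux_coef (b : MBasis 𝕜 X) (x : X) (A : Finset ℕ) (k : ℕ) :
    b.f k (x - b.proj A x) = if k ∈ A then 0 else b.f k x := by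
  unfold MBasis.proj
  rw [map_sub, map_sum]
  simp only [map_smul, b.biorth, smul_eq_mul, mul_ite, mul_one, mul_zero, Finset.sum_ite_eq]
  split_ifs <;> simp

/-- Quasi-greedy plus `w`-disjoint-super-democratic implies `w`-almost-greedy
with constant `C_q + 2 C_q C_sd`. -/
theorem stmt1 (b : MBasis 𝕜 X) (w : ℕ → ℝ) (hw : ∀ n, 0 < w n) (Cq Csd : ℝ)
    (hq : b.QuasiGreedy Cq) (hsd : b.WDisjSuperDemocratic w Csd) :
    b.WAlmostGreedy w (Cq + 2 * Cq * Csd) := by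
  classical
  intro x Λ hΛ A hA
  set y := x - b.proj A x with hy
  have hcoef : ∀ k, b.f k y = if k ∈ A then 0 else b.f k x := fun k => aux_coef b x A k
  have hg : b.IsGreedySet y (Λ \ A) := by
    intro n hn k hk
    simp only [Finset.mem_sdiff] at hn hk
    rw [hcoef, hcoef, if_neg hn.2]
    by_cases hkA : k ∈ A
    · simp [hkA]
    · rw [if_neg hkA]
      exact hΛ n hn.1 k (by tauto)
  have hy1 := hq y _ hg
  have hD : 0 ≤ Cq * ‖y‖ := (norm_nonneg _).trans hy1
  have hCsd : 0 ≤ Csd := by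
    have hpos : ∀ n, 0 < ‖b.e n‖ := fun n => b.c₁_pos.trans_le (b.c₁_le_e n)
    have key : ∀ i j : ℕ, i ≠ j → w i ≤ w j → 0 ≤ Csd := by
      intro i j hij hwij
      have := hsd {i} {j} (by simpa using hij) (by simpa [wSum] using hwij)
        (fun _ => 1) (fun _ => 1) (fun _ => by simp) (fun _ => by simp)
      simp only [MBasis.indic, Finset.sum_singleton, one_smul] at this
      by_contra hc
      nlinarith [hpos i, hpos j]
    rcases le_total (w 0) (w 1) with h | h
    · exact key 0 1 (by simp) h
    · exact key 1 0 (by simp) h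
  have hsplit : x - b.proj Λ x = (y - b.proj (Λ \ A) y) + b.proj (A \ Λ) x := by
    have e1 : b.proj (Λ \ A) y = b.proj (Λ \ A) x := by
      unfold MBasis.proj
      apply Finset.sum_congr rfl
      intro n hn
      rw [hcoef, if_neg (Finset.mem_sdiff.1 hn).2]
    have e2 : b.proj Λ x = b.proj (Λ ∩ A) x + b.proj (Λ \ A) x :=
      (Finset.sum_inter_add_sum_sdiff Λ A _).symm
    have e3 : b.proj A x = b.proj (A ∩ Λ) x + b.proj (A \ Λ) x :=
      (Finset.sum_inter_add_sum_sdiff A Λ _).symm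
    rw [e1, hy, e2, e3, Finset.inter_comm]
    abel
  have hw' : wSum w (A \ Λ) ≤ wSum w (Λ \ A) := by
    have e2 : wSum w Λ = wSum w (Λ ∩ A) + wSum w (Λ \ A) :=
      (Finset.sum_inter_add_sum_sdiff Λ A _).symm
    have e3 : wSum w A = wSum w (A ∩ Λ) + wSum w (A \ Λ) :=
      (Finset.sum_inter_add_sum_sdiff A Λ _).symm
    rw [e2, e3, Finset.inter_comm] at hA
    linarith
  have hdisj : Disjoint (A \ Λ) (Λ \ A) := by
    rw [Finset.disjoint_left]
    intro n hn hn'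
    simp only [Finset.mem_sdiff] at hn hn'
    tauto
  have main : ‖b.proj (A \ Λ) x‖ ≤ Csd * (2 * Cq * ‖y‖) := by
    have hR : 0 ≤ Csd * (2 * Cq * ‖y‖) := mul_nonneg hCsd (by linarith)
    rcases (A \ Λ).eq_empty_or_nonempty with hE | hne
    · rw [hE]; simpa [MBasis.proj] using hR
    obtain ⟨a, ha, hamax⟩ := Finset.exists_max_image (A \ Λ) (fun n => ‖b.f n x‖) hne
    set t := ‖b.f a x‖ with htdef
    rcases (norm_nonneg (b.f a x)).eq_or_lt with h0 | htpos
    · have : b.proj (A \ Λ) x = 0 := by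
        unfold MBasis.proj
        apply Finset.sum_eq_zero
        intro n hn
        have h1 := hamax n hn
        have : b.f n x = 0 := by
          rw [← norm_le_zero_iff]; linarith
        rw [this, zero_smul]
      rw [this]; simpa using hR
    rw [← htdef] at htpos
    obtain ⟨ε, hε, hεb⟩ := aux_trunc b Cq hq y (Λ \ A) hg t htpos (by
      intro n hn
      rw [Finset.mem_sdiff] at hn
      rw [hcoef, if_neg hn.2]
      exact hΛ n hn.1 a (Finset.mem_sdiff.1 ha).2)
    have hc := aux_convex_s1 b (A \ Λ) (Csd * ‖b.indic ε (Λ \ A)‖)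
      (fun ε' hε' => hsd _ _ hdisj hw' ε' ε hε' hε) (A \ Λ)
      (fun n => if n ∈ A \ Λ then b.f n x / (t : 𝕜) else 1)
      (by
        intro n hn
        rw [if_pos hn, norm_div, RCLike.norm_ofReal, abs_of_pos htpos]
        exact (div_le_one htpos).2 (hamax n hn))
      (by intro n hn; rw [if_neg hn]; simp)
    have e : b.proj (A \ Λ) x = (t : 𝕜) •
        b.indic (fun n => if n ∈ A \ Λ then b.f n x / (t : 𝕜) else 1) (A \ Λ) := by
      unfold MBasis.proj MBasis.indic
      rw [Finset.smul_sum]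
      apply Finset.sum_congr rfl
      intro n hn
      have ht0 : (t : 𝕜) ≠ 0 := by exact_mod_cast htpos.ne'
      beta_reduce
      rw [if_pos hn, smul_smul, mul_div_cancel₀ _ ht0]
    rw [e, norm_smul, RCLike.norm_ofReal, abs_of_pos htpos]
    calc _ ≤ t * (Csd * ‖b.indic ε (Λ \ A)‖) := mul_le_mul_of_nonneg_left hc htpos.le
      _ = Csd * (t * ‖b.indic ε (Λ \ A)‖) := by ring
      _ ≤ _ := mul_le_mul_of_nonneg_left hεb hCsd
  rw [hsplit]
  refine (norm_add_le _ _).trans ?_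
  linarith
end
end

section
/- Let B be a Schauder basis with basis constant 𝔎_b of a Banach space X over 𝔽 and let w be a weight. If B is C_sg-w-semi-greedy, then B is C_q-quasi-greedy with C_q ≤ C_sg·𝔎_b·(1 + (1 + 𝔎_b)C_sg + c₂²) and C_s-w-super-democratic with C_s ≤ 𝔎_b·C_sg·((1 + 𝔎_b)C_sg + c₂²). -/
open scoped BigOperators NNReal

noncomputable section

variable {𝕜 : Type*} [RCLike 𝕜] {X : Type*} [NormedAddCommGroup X] [NormedSpace 𝕜 X]
  [CompleteSpace X]

open MBasis

/-- indicator with signs -/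
def ixd {𝕜 : Type*} [RCLike 𝕜] (ε : ℕ → 𝕜) (A : Finset ℕ) : ℕ → 𝕜 := fun n => if n ∈ A then ε n else 0

/-- abstract coordinates setting -/
structure Core (𝕜 : Type*) [RCLike 𝕜] (w : ℕ → ℝ) (K C c : ℝ) (M : ℕ) (N : (ℕ → 𝕜) → ℝ) : Prop where
  hw : ∀ n, 0 < w n
  K1 : 1 ≤ K
  C1 : 1 ≤ C
  c0 : 0 < c
  c1 : 1 ≤ c ^ 2
  add : ∀ a b, N (a + b) ≤ N a + N b
  smul : ∀ (t : 𝕜) a, N (t • a) = ‖t‖ * N a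
  cut : ∀ a (m : ℕ), N (fun n => if n < m then a n else 0) ≤ K * N a
  coef : ∀ a, ∀ n < M, ‖a n‖ ≤ c * N a
  unit : ∀ a : ℕ → 𝕜, ∀ q, (∀ n, n ≠ q → a n = 0) → ‖a q‖ = 1 → N a ≤ c
  sg : ∀ (a d : ℕ → 𝕜) (L S : Finset ℕ) (t : ℝ), L ⊆ Finset.range M → S ⊆ Finset.range M →
    ∑ i ∈ S, w i ≤ ∑ i ∈ L, w i → (∀ n ∈ L, t ≤ ‖a n‖) → (∀ n, n ∉ L → ‖a n‖ ≤ t) →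
    (∀ n, n ∉ S → a n = d n) → ∃ a', (∀ n, n ∉ L → a' n = a n) ∧ N a' ≤ C * N d

namespace Core
variable {𝕜 : Type*} [RCLike 𝕜] {w : ℕ → ℝ} {K C c : ℝ} {M : ℕ} {N : (ℕ → 𝕜) → ℝ}

lemma neg (h : Core 𝕜 w K C c M N) (a : ℕ → 𝕜) : N (-a) = N a := by
  have := h.smul (-1) a
  simpa using this

lemma sub (h : Core 𝕜 w K C c M N) (a b : ℕ → 𝕜) : N (a - b) ≤ N a + N b := by
  rw [sub_eq_add_neg]
  exact (h.add _ _).trans (by rw [h.neg])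

lemma nonneg (h : Core 𝕜 w K C c M N) (a : ℕ → 𝕜) : 0 ≤ N a := by
  have h1 := h.sub a a
  have h2 := h.smul 0 a
  simp at h1 h2
  linarith

lemma half (h : Core 𝕜 w K C c M N) (a b d : ℕ → 𝕜) (R : ℝ) (ha : N a ≤ R) (hb : N b ≤ R)
    (hd : ∀ n, d n + d n = a n - b n) : N d ≤ R := by
  have e : (2 : 𝕜) • d = a - b := by
    ext n; simp [two_mul, hd]
  have h1 := h.smul 2 d
  rw [e] at h1
  have h2 := h.sub a b
  simp at h1
  linarith

lemma tail (h : Core 𝕜 w K C c M N) (a : ℕ → 𝕜) (m : ℕ) :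
    N (fun n => if m ≤ n then a n else 0) ≤ (1 + K) * N a := by
  have e : (fun n => if m ≤ n then a n else 0) = a - (fun n => if n < m then a n else 0) := by
    ext n
    by_cases hn : m ≤ n
    · simp [hn, not_lt.2 hn]
    · simp [hn, not_le.1 hn]
  rw [e]
  have := h.sub a (fun n => if n < m then a n else 0)
  have := h.cut a m
  linarith

lemma LX (h : Core 𝕜 w K C c M N) {ε ε' : ℕ → 𝕜} (he : ∀ n, ‖ε n‖ = 1) (he' : ∀ n, ‖ε' n‖ = 1)
    {A B : Finset ℕ} (hA : A ⊆ Finset.range M) (hB : B ⊆ Finset.range M) (p : ℕ)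
    (hAp : ∀ n ∈ A, n < p) (hwt : ∑ i ∈ A, w i ≤ ∑ i ∈ B with p ≤ i, w i) :
    N (ixd ε A) ≤ K * (C * N (ixd ε' B)) := by
  have key : ∀ σ : 𝕜, ‖σ‖ = 1 →
      N (fun n => if n < p then (if n ∈ A then σ * ε n else ixd ε' B n) else 0)
        ≤ K * (C * N (ixd ε' B)) := by
    intro σ hσ
    obtain ⟨a', h1, h2⟩ := h.sg (fun n => if n ∈ A then σ * ε n else ixd ε' B n) (ixd ε' B)
      (B.filter (fun i => p ≤ i)) A 1 ((Finset.filter_subset _ _).trans hB) hA hwt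
      (by
        intro n hn
        simp only [Finset.mem_filter] at hn
        have : n ∉ A := fun hh => by have := hAp n hh; omega
        simp [this, ixd, hn.1, he'])
      (by
        intro n hn
        by_cases h1 : n ∈ A
        · simp [h1, he, hσ]
        · by_cases h2 : n ∈ B <;> simp [h1, h2, ixd, he'])
      (by
        intro n hn
        simp [hn])
    have h3 := h.cut a' p
    have e : (fun n => if n < p then (if n ∈ A then σ * ε n else ixd ε' B n) else 0)
        = (fun n => if n < p then a' n else 0) := by
      ext n
      by_cases hn : n < p
      · rw [if_pos hn, if_pos hn, h1 n (by simp; omega)]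
      · simp [hn]
    rw [e]
    exact h3.trans (mul_le_mul_of_nonneg_left h2 (by linarith [h.K1]))
  refine h.half _ _ _ _ (key 1 (by simp)) (key (-1) (by simp)) ?_
  intro n
  by_cases h1 : n ∈ A
  · simp [ixd, h1, hAp n h1]
  · simp [ixd, h1]

lemma LY (h : Core 𝕜 w K C c M N) {ε ε' : ℕ → 𝕜} (he : ∀ n, ‖ε n‖ = 1) (he' : ∀ n, ‖ε' n‖ = 1)
    {A B H : Finset ℕ} (hA : A ⊆ Finset.range M) (hB : B ⊆ Finset.range M)
    (hH : H ⊆ Finset.range M) (p r : ℕ) (hpr : p ≤ r)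
    (hHr : ∀ n ∈ H, n < r) (hwH : ∑ i ∈ H, w i ≤ ∑ i ∈ B with r ≤ i, w i)
    (hAr : ∀ n ∈ A, r ≤ n) (hwA : ∑ i ∈ A, w i ≤ ∑ i ∈ B ∪ H with i < p, w i) :
    N (fun n => if p ≤ n ∧ n < r then (if n ∈ H then ε n else ixd ε' B n) else ixd ε A n)
      ≤ (1 + K) * (C * (K * (C * N (ixd ε' B)))) := by
  have hK := h.K1
  have hC := h.C1
  obtain ⟨a', h1, h2⟩ := h.sg (fun n => if n ∈ H then ε n else ixd ε' B n) (ixd ε' B)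
      (B.filter (fun i => r ≤ i)) H 1 ((Finset.filter_subset _ _).trans hB) hH hwH
      (by
        intro n hn
        simp only [Finset.mem_filter] at hn
        have : n ∉ H := fun hh => by have := hHr n hh; omega
        simp [this, ixd, hn.1, he'])
      (by
        intro n hn
        by_cases h1 : n ∈ H
        · simp [h1, he]
        · by_cases h2 : n ∈ B <;> simp [h1, h2, ixd, he'])
      (by
        intro n hn
        simp [hn])
  have h3 := h.cut a' r
  set u : ℕ → 𝕜 := fun n => if n < r then a' n else 0 with hu
  have hun : ∀ n, n < r → u n = if n ∈ H then ε n else ixd ε' B n := by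
    intro n hn
    rw [hu]; simp only [hn, if_true]
    rw [h1 n (by simp; omega)]
  have hun' : ∀ n, r ≤ n → u n = 0 := by
    intro n hn
    simp [hu, not_lt.2 hn]
  obtain ⟨d, h4, h5⟩ := h.sg (fun n => if n ∈ A then ε n else u n) u
      ((B ∪ H).filter (fun i => i < p)) A 1
      ((Finset.filter_subset _ _).trans (Finset.union_subset hB hH)) hA hwA
      (by
        intro n hn
        simp only [Finset.mem_filter, Finset.mem_union] at hn
        have : n ∉ A := fun hh => by have := hAr n hh; omega
        simp only [this, if_false]
        rw [hun n (by omega)]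
        by_cases h6 : n ∈ H
        · simp [h6, he]
        · have : n ∈ B := by tauto
          simp [h6, this, ixd, he'])
      (by
        intro n hn
        by_cases h6 : n ∈ A
        · simp [h6, he]
        · simp only [h6, if_false]
          by_cases h7 : n < r
          · rw [hun n h7]
            by_cases h1 : n ∈ H
            · simp [h1, he]
            · by_cases h2 : n ∈ B <;> simp [h1, h2, ixd, he']
          · rw [hun' n (by omega)]; simp)
      (by
        intro n hn
        simp [hn])
  have h6 := h.tail d p
  have e : (fun n => if p ≤ n ∧ n < r then (if n ∈ H then ε n else ixd ε' B n) else ixd ε A n)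
      = (fun n => if p ≤ n then d n else 0) := by
    ext n
    by_cases hn : p ≤ n
    · rw [if_pos hn, h4 n (by simp; omega)]
      by_cases h7 : n < r
      · have : n ∉ A := fun hh => by have := hAr n hh; omega
        rw [if_pos ⟨hn, h7⟩, if_neg this, hun n h7]
      · rw [if_neg (by tauto), hun' n (by omega)]
        simp [ixd]
    · have : n ∉ A := fun hh => by have := hAr n hh; omega
      simp [hn, ixd, this]
  rw [e]
  have h7 : N u ≤ K * (C * N (ixd ε' B)) :=
    h3.trans (mul_le_mul_of_nonneg_left h2 (by linarith))
  exact h6.trans (mul_le_mul_of_nonneg_left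
    (h5.trans (mul_le_mul_of_nonneg_left h7 (by linarith))) (by linarith))

lemma LZ (h : Core 𝕜 w K C c M N) {ε ε' : ℕ → 𝕜} (he : ∀ n, ‖ε n‖ = 1) (he' : ∀ n, ‖ε' n‖ = 1)
    {A B G : Finset ℕ} (hA : A ⊆ Finset.range M) (hB : B ⊆ Finset.range M) (r : ℕ)
    (hAr : ∀ n ∈ A, r ≤ n) (hG : G ⊆ B) (hGr : ∀ n ∈ G, n < r)
    (hwt : ∑ i ∈ A, w i ≤ ∑ i ∈ G, w i) :
    ∃ v : ℕ → 𝕜, (∀ n, n ∉ G → v n = ixd ε A n) ∧ N v ≤ C * N (ixd ε' B) := by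
  have key : ∀ σ : 𝕜, ‖σ‖ = 1 → ∃ v : ℕ → 𝕜,
      (∀ n, n ∉ G → v n = (if n ∈ A then σ * ε n else ixd ε' B n)) ∧
        N v ≤ C * N (ixd ε' B) := by
    intro σ hσ
    exact h.sg (fun n => if n ∈ A then σ * ε n else ixd ε' B n) (ixd ε' B)
      G A 1 (hG.trans hB) hA hwt
      (by
        intro n hn
        have : n ∉ A := fun hh => by have := hAr n hh; have := hGr n hn; omega
        simp [this, ixd, hG hn, he'])
      (by
        intro n hn
        by_cases h1 : n ∈ A
        · simp [h1, he, hσ]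
        · by_cases h2 : n ∈ B <;> simp [h1, h2, ixd, he'])
      (by
        intro n hn
        simp [hn])
  obtain ⟨v1, h1, h2⟩ := key 1 (by simp)
  obtain ⟨v2, h3, h4⟩ := key (-1) (by simp)
  refine ⟨(1 / 2 : 𝕜) • (v1 - v2), ?_, h.half _ _ _ _ h2 h4 ?_⟩
  · intro n hn
    simp only [Pi.smul_apply, Pi.sub_apply, h1 n hn, h3 n hn, smul_eq_mul, ixd]
    by_cases h1 : n ∈ A
    · simp [h1]; ring
    · simp [h1]
  · intro n
    simp only [Pi.smul_apply, Pi.sub_apply, smul_eq_mul]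
    ring

lemma LZ' (h : Core 𝕜 w K C c M N) {ε ε' : ℕ → 𝕜} (he : ∀ n, ‖ε n‖ = 1) (he' : ∀ n, ‖ε' n‖ = 1)
    {A B G : Finset ℕ} (hA : A ⊆ Finset.range M) (hB : B ⊆ Finset.range M) (r : ℕ)
    (hAr : ∀ n ∈ A, r ≤ n) (hG : G ⊆ B) (hGr : ∀ n ∈ G, n < r)
    (hwt : ∑ i ∈ A, w i ≤ ∑ i ∈ G, w i) :
    N (ixd ε A) ≤ (1 + K) * (C * N (ixd ε' B)) := by
  obtain ⟨v, h1, h2⟩ := h.LZ he he' hA hB r hAr hG hGr hwt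
  have h3 := h.tail v r
  have e : ixd ε A = (fun n => if r ≤ n then v n else 0) := by
    ext n
    by_cases hn : r ≤ n
    · rw [if_pos hn, h1 n (fun hh => by have := hGr n hh; omega)]
    · have : n ∉ A := fun hh => hn (hAr n hh)
      simp [hn, ixd, this]
  rw [e]
  exact h3.trans (mul_le_mul_of_nonneg_left h2 (by linarith [h.K1]))

lemma LC (h : Core 𝕜 w K C c M N) {ε ε' : ℕ → 𝕜} (he : ∀ n, ‖ε n‖ = 1) (he' : ∀ n, ‖ε' n‖ = 1)
    {D B L : Finset ℕ} (hD : D ⊆ Finset.range M) (hB : B ⊆ Finset.range M)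
    (hL : L ⊆ Finset.range M) (p r : ℕ) (hpr : p ≤ r)
    (hDr : ∀ n ∈ D, r ≤ n) (hBL : ∀ n ∈ B, n < p → n ∈ L)
    (hw1 : ∑ i ∈ D \ B, w i ≤ ∑ i ∈ B \ D with (i < p ∨ r ≤ i), w i)
    (hw2 : ∑ i ∈ L, w i ≤ ∑ i ∈ D, w i) (y : ℕ → 𝕜) (hy : ∀ n, ‖y n‖ ≤ 1)
    (hyL : ∀ n, n ∉ L → y n = 0) :
    N (fun n => if n < p then y n else if n < r then ixd ε' B n else 0)
      ≤ K * (C * (C * N (ixd ε' B))) := by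
  have hK := h.K1
  have hC := h.C1
  obtain ⟨v, h1, h2⟩ := h.sg (fun n => if n ∈ D \ B then ε n else ixd ε' B n) (ixd ε' B)
      ((B \ D).filter (fun i => (i < p ∨ r ≤ i))) (D \ B) 1
      ((Finset.filter_subset _ _).trans (Finset.sdiff_subset.trans hB))
      (Finset.sdiff_subset.trans hD) hw1
      (by
        intro n hn
        simp only [Finset.mem_filter, Finset.mem_sdiff] at hn
        simp [ixd, hn.1, he'])
      (by
        intro n hn
        by_cases h1 : n ∈ D \ B
        · simp only [h1, if_true, he, le_refl]
        · simp only [h1, if_false]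
          by_cases h2 : n ∈ B <;> simp [h2, ixd, he'])
      (by
        intro n hn
        simp only [hn, if_false])
  have hle : ∀ n, n ∉ (B \ D).filter (fun i => (i < p ∨ r ≤ i)) → ‖v n‖ ≤ 1 := by
    intro n hn
    rw [h1 n hn]
    by_cases h1 : n ∈ D \ B
    · simp only [h1, if_true, he, le_refl]
    · simp only [h1, if_false]
      by_cases h2 : n ∈ B <;> simp [h2, ixd, he']
  have hwL : ∑ i ∈ D, w i ≤ ∑ i ∈ D ∪ B.filter (fun i => r ≤ i ∧ 1 ≤ ‖v i‖), w i :=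
    Finset.sum_le_sum_of_subset_of_nonneg Finset.subset_union_left
      (fun i _ _ => (h.hw i).le)
  obtain ⟨d, h4, h5⟩ := h.sg (fun n => if n < p then y n else v n) v
      (D ∪ B.filter (fun i => r ≤ i ∧ 1 ≤ ‖v i‖)) (L.filter (fun i => i < p)) 1
      (Finset.union_subset hD ((Finset.filter_subset _ _).trans hB))
      ((Finset.filter_subset _ _).trans hL)
      ((Finset.sum_le_sum_of_subset_of_nonneg (Finset.filter_subset _ _)
        (fun i _ _ => (h.hw i).le)).trans (hw2.trans hwL))
      (by
        intro n hn
        simp only [Finset.mem_union, Finset.mem_filter] at hn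
        rcases hn with hn | hn
        · have h6 := hDr n hn
          rw [if_neg (by omega), h1 n (by simp [hn])]
          by_cases h7 : n ∈ B <;> simp [h7, hn, ixd, he, he']
        · rw [if_neg (by omega)]
          exact hn.2.2)
      (by
        intro n hn
        by_cases h6 : n < p
        · simp only [h6, if_true]; exact hy n
        · simp only [h6, if_false]
          by_cases h7 : n ∈ (B \ D).filter (fun i => (i < p ∨ r ≤ i))
          · simp only [Finset.mem_filter, Finset.mem_sdiff, Finset.mem_union, not_or, not_and,
              not_le] at h7 hn
            exact (hn.2 h7.1.1 (by omega)).le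
          · exact hle n h7)
      (by
        intro n hn
        by_cases h6 : n < p
        · have hnL : n ∉ L := fun hh => hn (by simp [hh, h6])
          have hnB : n ∉ B := fun hh => hnL (hBL n hh h6)
          have hnD : n ∉ D := fun hh => by have := hDr n hh; omega
          simp only [h6, if_true]
          rw [hyL n hnL, h1 n (by simp [hnB])]
          simp [hnB, hnD, ixd]
        · simp only [h6, if_false])
  have h6 := h.cut d r
  have e : (fun n => if n < p then y n else if n < r then ixd ε' B n else 0)
      = (fun n => if n < r then d n else 0) := by
    ext n
    by_cases hn : n < r
    · have hnD : n ∉ D := fun hh => by have := hDr n hh; omega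
      rw [if_pos hn, if_pos hn, h4 n (by simp [hnD]; omega)]
      by_cases h7 : n < p
      · simp [h7]
      · simp only [h7, if_false]
        rw [h1 n (by simp; omega)]
        simp [hnD]
    · rw [if_neg (by omega), if_neg hn, if_neg hn]
  rw [e]
  exact h6.trans (mul_le_mul_of_nonneg_left
    (h5.trans (mul_le_mul_of_nonneg_left h2 (by linarith))) (by linarith))

end Core

namespace Core
variable {𝕜 : Type*} [RCLike 𝕜] {w : ℕ → ℝ} {K C c : ℝ} {M : ℕ} {N : (ℕ → 𝕜) → ℝ}

lemma spl (w : ℕ → ℝ) (S : Finset ℕ) (q : ℕ) :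
    ∑ i ∈ S, w i = ∑ i ∈ S with i < q, w i + ∑ i ∈ S with q ≤ i, w i := by
  rw [← Finset.sum_filter_add_sum_filter_not S (fun i => i < q)]
  simp only [not_lt]

lemma spl_lt (w : ℕ → ℝ) (S : Finset ℕ) (q : ℕ) :
    ∑ i ∈ S with i < q + 1, w i = ∑ i ∈ S with i < q, w i + if q ∈ S then w q else 0 := by
  simp only [Finset.sum_filter]
  have : (if q ∈ S then w q else 0) = ∑ i ∈ S, if q = i then w i else 0 := by
    simp
  rw [this, ← Finset.sum_add_distrib]
  refine Finset.sum_congr rfl fun i _ => ?_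
  rcases lt_trichotomy i q with h | h | h
  · rw [if_pos (by omega), if_pos h, if_neg (by omega)]; simp
  · subst h; simp
  · rw [if_neg (by omega), if_neg (by omega), if_neg (by omega)]; simp

lemma spl_ge (w : ℕ → ℝ) (S : Finset ℕ) (q : ℕ) :
    ∑ i ∈ S with q ≤ i, w i = ∑ i ∈ S with q + 1 ≤ i, w i + if q ∈ S then w q else 0 := by
  have h1 := spl w S q
  have h2 := spl w S (q + 1)
  have h3 := spl_lt w S q
  linarith

lemma sd (w : ℕ → ℝ) (D B : Finset ℕ) (h : ∑ i ∈ D, w i ≤ ∑ i ∈ B, w i) :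
    ∑ i ∈ D \ B, w i ≤ ∑ i ∈ B \ D, w i := by
  have h1 := Finset.sum_inter_add_sum_sdiff D B w
  have h2 := Finset.sum_inter_add_sum_sdiff B D w
  rw [Finset.inter_comm] at h2
  linarith

lemma ar1 {K C c β : ℝ} (hK : 1 ≤ K) (hC : 1 ≤ C) (hc : 1 ≤ c ^ 2) (hβ : 0 ≤ β) :
    K * (C * β) + (1 + K) * (C * (K * (C * β))) ≤ K * C * ((1 + K) * C + c ^ 2) * β := by
  have : 0 ≤ (K * C * β) * (c ^ 2 - 1) :=
    mul_nonneg (by positivity) (by linarith)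
  nlinarith

lemma ar2 {K C c β : ℝ} (hK : 1 ≤ K) (hC : 1 ≤ C) (hc : 1 ≤ c ^ 2) (hβ : 0 ≤ β) :
    K * (C * β) + (1 + K) * (C * β) ≤ K * C * ((1 + K) * C + c ^ 2) * β := by
  refine le_trans ?_ (ar1 hK hC hc hβ)
  have h1 : C * β ≤ C * (K * (C * β)) := by
    have : 1 * β ≤ (K * C) * β := mul_le_mul_of_nonneg_right (by nlinarith) hβ
    refine mul_le_mul_of_nonneg_left ?_ (by linarith)
    linarith
  have := mul_le_mul_of_nonneg_left h1 (by linarith : (0:ℝ) ≤ 1 + K)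
  linarith

lemma ar3 {K C c β : ℝ} (hK : 1 ≤ K) (hC : 1 ≤ C) (hc : 1 ≤ c ^ 2) (hβ : 0 ≤ β) :
    K * (C * (C * β)) + (1 + K) * (C * β) ≤ K * C * ((1 + K) * C + c ^ 2) * β := by
  have h0 : 0 ≤ (K * C * β) * (c ^ 2 - 1) :=
    mul_nonneg (by positivity) (by linarith)
  have h1 : C * β ≤ K * K * C * (C * β) := by
    have : 1 ≤ K * K * C := by nlinarith [mul_self_nonneg (K-1), mul_nonneg (by linarith : 0 ≤ K) (by linarith : 0 ≤ K)]
    have h2 := mul_le_mul_of_nonneg_right this (by positivity : 0 ≤ C * β)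
    linarith
  nlinarith

lemma ar4 {K C c β : ℝ} (hK : 1 ≤ K) (hC : 1 ≤ C) (hc0 : 0 < c) (hc : 1 ≤ c ^ 2)
    (hβ : 1 ≤ c * β) :
    C * β + K * (C * (C * β)) + (1 - 1 / (c * (C * β))) * (K * (C * β)) + c
      ≤ K * C * ((1 + K) * C + c ^ 2) * β := by
  have hb : 0 < β := by
    by_contra hh
    have := mul_nonpos_of_nonneg_of_nonpos hc0.le (not_lt.1 hh)
    linarith
  obtain ⟨g, hg⟩ : ∃ g, g = 1 / c := ⟨_, rfl⟩
  have hgc : g * c = 1 := by rw [hg]; field_simp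
  have hg0 : 0 < g := by rw [hg]; positivity
  have e1 : 1 / (c * (C * β)) * (K * (C * β)) = K * g := by
    rw [hg]; field_simp
  have h1 : C * β ≤ K * K * C * (C * β) := by
    have : 1 ≤ K * K * C := by nlinarith [mul_self_nonneg (K-1), mul_nonneg (by linarith : 0 ≤ K) (by linarith : 0 ≤ K)]
    have h2 := mul_le_mul_of_nonneg_right this (by positivity : 0 ≤ C * β)
    linarith
  have h2 : g ≤ β := by
    have := mul_le_mul_of_nonneg_left hβ hg0.le
    rw [← mul_assoc, hgc] at this
    linarith
  have h3 : β ≤ K * C * β := by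
    have : 1 * β ≤ (K * C) * β := mul_le_mul_of_nonneg_right (by nlinarith) hb.le
    linarith
  have h4 : 0 ≤ (c ^ 2 - 1) * (K * C * β - g) := mul_nonneg (by linarith) (by linarith)
  have h5 : c ^ 2 * g = c := by
    calc c ^ 2 * g = c * (g * c) := by ring
      _ = c := by rw [hgc, mul_one]
  have h6 : g ≤ K * g := by nlinarith
  have h7 : (1 - 1 / (c * (C * β))) * (K * (C * β)) = K * (C * β) - K * g := by
    rw [sub_mul, e1, one_mul]
  rw [h7]
  nlinarith

/-- the hypotheses of the split -/
structure Spt (w : ℕ → ℝ) (M : ℕ) (A B : Finset ℕ) (q : ℕ) : Prop where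
  hA : A ⊆ Finset.range M
  hB : B ⊆ Finset.range M
  hwt : ∑ i ∈ A, w i ≤ ∑ i ∈ B, w i
  h1 : ∑ i ∈ A with i < q, w i + ∑ i ∈ B with i < q, w i ≤ ∑ i ∈ B, w i
  h2 : ∑ i ∈ B, w i < ∑ i ∈ A with i < q + 1, w i + ∑ i ∈ B with i < q + 1, w i

section
variable {A B : Finset ℕ} {q : ℕ} {ε ε' : ℕ → 𝕜}

lemma sX (h : Core 𝕜 w K C c M N) (s : Spt w M A B q) (he : ∀ n, ‖ε n‖ = 1)
    (he' : ∀ n, ‖ε' n‖ = 1) :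
    N (ixd ε (A.filter (fun i => i < q))) ≤ K * (C * N (ixd ε' B)) := by
  refine h.LX he he' ((Finset.filter_subset _ _).trans s.hA) s.hB q (by simp) ?_
  have := spl w B q
  have := s.h1
  linarith

lemma case1 (h : Core 𝕜 w K C c M N) (s : Spt w M A B q) (he : ∀ n, ‖ε n‖ = 1)
    (he' : ∀ n, ‖ε' n‖ = 1) (hq : q ∉ A) :
    N (ixd ε A) ≤ K * C * ((1 + K) * C + c ^ 2) * N (ixd ε' B) := by
  have a1 := h.sX s he he'
  have a2 := h.LZ' (A := A.filter (fun i => q + 1 ≤ i)) (G := B.filter (fun i => i < q + 1)) he he'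
    ((Finset.filter_subset _ _).trans s.hA) s.hB (q + 1) (by simp)
    (Finset.filter_subset _ _) (by simp)
    (by
      have := spl w A (q + 1)
      have := s.h2
      have := s.hwt
      linarith)
  have e : ixd ε A = ixd ε (A.filter (fun i => i < q)) + ixd ε (A.filter (fun i => q + 1 ≤ i)) := by
    ext n
    by_cases hn : n ∈ A
    · have : n ≠ q := fun hh => hq (hh ▸ hn)
      rcases lt_or_gt_of_ne this with h | h
      · simp [ixd, hn, h]; omega
      · have h' : ¬ n < q := by omega
        have h'' : q < n := by omega
        simp [ixd, hn, h', h'']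
    · simp [ixd, hn]
  rw [e]
  have := h.add (ixd ε (A.filter (fun i => i < q))) (ixd ε (A.filter (fun i => q + 1 ≤ i)))
  have := ar2 h.K1 h.C1 h.c1 (h.nonneg (ixd ε' B))
  linarith

/-- combination of LX and LY -/
lemma comb (h : Core 𝕜 w K C c M N) (s : Spt w M A B q) (he : ∀ n, ‖ε n‖ = 1)
    (he' : ∀ n, ‖ε' n‖ = 1) (v : ℕ → 𝕜)
    (hv : N v ≤ (1 + K) * (C * (K * (C * N (ixd ε' B)))))
    (e : ∀ n, ixd ε A n = ixd ε (A.filter (fun i => i < q)) n + v n) :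
    N (ixd ε A) ≤ K * C * ((1 + K) * C + c ^ 2) * N (ixd ε' B) := by
  have a1 := h.sX s he he'
  have e : ixd ε A = ixd ε (A.filter (fun i => i < q)) + v := funext e
  rw [e]
  have := h.add (ixd ε (A.filter (fun i => i < q))) v
  have := ar1 h.K1 h.C1 h.c1 (h.nonneg (ixd ε' B))
  linarith

lemma case2 (h : Core 𝕜 w K C c M N) (s : Spt w M A B q) (he : ∀ n, ‖ε n‖ = 1)
    (he' : ∀ n, ‖ε' n‖ = 1) (hq : q ∈ A) (hqB : q ∉ B) :
    N (ixd ε A) ≤ K * C * ((1 + K) * C + c ^ 2) * N (ixd ε' B) := by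
  have A0 := spl w A q
  have A1 := spl_lt w A q
  have A2 := spl_ge w A q
  have B0 := spl w B q
  have B1 := spl_lt w B q
  have B2 := spl_ge w B q
  rw [if_pos hq] at A1 A2
  rw [if_neg hqB] at B1 B2
  have s1 := s.h1
  have s2 := s.h2
  have s3 := s.hwt
  have hqM : q ∈ Finset.range M := s.hA hq
  by_cases c1 : w q ≤ ∑ i ∈ B with q + 1 ≤ i, w i
  · refine h.comb s he he' _ (h.LY (A := A.filter (fun i => q + 1 ≤ i)) (H := {q}) he he'
      ((Finset.filter_subset _ _).trans s.hA) s.hB (by simpa using hqM) q (q + 1) (by omega)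
      (by simp) (by simpa using c1) (by simp) ?_) ?_
    · have : ∑ i ∈ B with i < q, w i ≤ ∑ i ∈ B ∪ {q} with i < q, w i :=
        Finset.sum_le_sum_of_subset_of_nonneg
          (Finset.filter_subset_filter _ Finset.subset_union_left) (fun i _ _ => (h.hw i).le)
      linarith
    · intro n
      rcases lt_trichotomy n q with hh | hh | hh
      · have h1 : ¬ q ≤ n := by omega
        have h2 : ¬ q < n := by omega
        simp [ixd, h1, h2, hh]
      · subst hh
        simp [ixd, hq]
      · have h1 : ¬ n < q := by omega
        have h2 : q < n := by omega
        have h3 : ¬ n < q + 1 := by omega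
        simp [ixd, h1, h2, h3]
  by_cases c2 : ∑ i ∈ A with q ≤ i, w i ≤ ∑ i ∈ B ∪ A.filter (fun i => i < q) with i < q, w i
  · refine h.comb s he he' _ (h.LY (A := A.filter (fun i => q ≤ i)) (H := A.filter (fun i => i < q))
      he he' ((Finset.filter_subset _ _).trans s.hA) s.hB
      ((Finset.filter_subset _ _).trans s.hA) q q le_rfl
      (by simp) (by linarith) (by simp) c2) ?_
    intro n
    rcases lt_or_ge n q with hh | hh
    · have h1 : ¬ q ≤ n := by omega
      simp [ixd, h1, hh]
    · have h1 : ¬ n < q := by omega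
      simp [ixd, h1, hh]
  push Not at c1 c2
  set β := N (ixd ε' B) with hβ
  have hβ0 : 0 ≤ β := h.nonneg _
  have hBne : ∃ j, j ∈ B := by
    by_contra hh
    push Not at hh
    have hB0 : B = ∅ := Finset.eq_empty_of_forall_notMem hh
    have : w q ≤ ∑ i ∈ A, w i := Finset.single_le_sum (fun i _ => (h.hw i).le) hq
    have := h.hw q
    simp [hB0] at s3
    linarith
  obtain ⟨j, hj⟩ := hBne
  have hcb : 1 ≤ c * β := by
    have := h.coef (ixd ε' B) j (Finset.mem_range.1 (s.hB hj))
    simpa [ixd, hj, he'] using this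
  have hc0 := h.c0
  have hC1 := h.C1
  have hK1 := h.K1
  have hMu : 1 ≤ c * (C * β) := by nlinarith
  set Mu := c * (C * β) with hMudef
  obtain ⟨v, hv1, hv2⟩ := h.LZ (A := A.filter (fun i => q + 1 ≤ i))
    (G := (B.filter (fun i => i < q)) \ A) he he'
    ((Finset.filter_subset _ _).trans s.hA) s.hB (q + 1) (by simp)
    (Finset.sdiff_subset.trans (Finset.filter_subset _ _))
    (by intro n hn; simp at hn; omega)
    (by
      have t1 := Finset.sum_inter_add_sum_sdiff (B.filter (fun i => i < q)) A w
      have t2 : ∑ i ∈ (B.filter (fun i => i < q)) ∩ A, w i ≤ ∑ i ∈ A with i < q, w i :=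
        Finset.sum_le_sum_of_subset_of_nonneg (by intro n hn; simp at hn ⊢; tauto)
          (fun i _ _ => (h.hw i).le)
      linarith)
  rw [← hβ] at hv2
  have hvG : ∀ n, n < q → n ∉ (B.filter (fun i => i < q)) \ A → v n = 0 := by
    intro n hn hn'
    rw [hv1 n hn']
    have : ¬ q < n := by omega
    simp [ixd, this]
  have hMu0 : 0 < Mu := by linarith
  have hvM : ∀ n, n < q → ‖v n‖ ≤ Mu := by
    intro n hn
    have h1 := h.coef v n (by have := Finset.mem_range.1 hqM; omega)
    exact h1.trans (mul_le_mul_of_nonneg_left hv2 hc0.le)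
  have hy := h.LC (D := A.filter (fun i => q ≤ i)) (B := B)
    (L := B.filter (fun i => i < q) ∪ A.filter (fun i => i < q)) he he'
    ((Finset.filter_subset _ _).trans s.hA) s.hB
    (Finset.union_subset ((Finset.filter_subset _ _).trans s.hB)
      ((Finset.filter_subset _ _).trans s.hA)) q q le_rfl (by simp)
    (by intro n hn hn'; simp [hn, hn'])
    (by
      have t1 : (B \ A.filter (fun i => q ≤ i)).filter (fun i => i < q ∨ q ≤ i)
          = B \ A.filter (fun i => q ≤ i) :=
        Finset.filter_true_of_mem (fun i _ => lt_or_ge i q)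
      rw [t1]
      have : 0 ≤ ∑ i ∈ A with i < q, w i := Finset.sum_nonneg (fun i _ => (h.hw i).le)
      exact sd w _ _ (by linarith))
    (by
      have t1 : (B ∪ A.filter (fun i => i < q)).filter (fun i => i < q)
          = B.filter (fun i => i < q) ∪ A.filter (fun i => i < q) := by
        ext i; simp; tauto
      rw [t1] at c2
      exact c2.le)
    (fun n => if n < q then ((1 / Mu : ℝ) : 𝕜) * v n - ixd ε (A.filter (fun i => i < q)) n else 0)
    (by
      intro n
      by_cases hn : n < q
      · simp only [hn, if_true]
        by_cases hnA : n ∈ A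
        · rw [hvG n hn (by simp [hnA])]
          simp [ixd, hnA, hn, he]
        · have : ixd ε (A.filter (fun i => i < q)) n = 0 := by simp [ixd, hnA]
          rw [this, sub_zero, norm_mul, RCLike.norm_ofReal, abs_of_pos (by positivity),
            div_mul_eq_mul_div, one_mul, div_le_one hMu0]
          exact hvM n hn
      · simp [hn])
    (by
      intro n hn
      by_cases hnq : n < q
      · simp only [Finset.mem_union, Finset.mem_filter, hnq, and_true, not_or] at hn
        simp only [hnq, if_true]
        rw [hvG n hnq (by simp [hn])]
        simp [ixd, hn]
      · simp [hnq])
  rw [← hβ] at hy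
  set yy := (fun n => if n < q then
      (if n < q then ((1 / Mu : ℝ) : 𝕜) * v n - ixd ε (A.filter (fun i => i < q)) n else 0)
      else if n < q then ixd ε' B n else 0) with hyy
  have hu := h.cut v q
  set u := (fun n => if n < q then v n else 0) with huu
  have he1 := h.unit (ixd ε {q}) q (by intro n hn; simp [ixd, hn]) (by simp [ixd, he])
  have E : ixd ε A = ((v - yy) - ((1 - 1 / Mu : ℝ) : 𝕜) • u) + ixd ε {q} := by
    ext n
    simp only [Pi.add_apply, Pi.sub_apply, Pi.smul_apply, smul_eq_mul, hyy, huu]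
    rcases lt_trichotomy n q with hh | hh | hh
    · have : n ≠ q := by omega
      simp [ixd, hh, this]
      ring
    · subst hh
      rw [hv1 n (by simp)]
      simp [ixd, hq]
    · rw [hv1 n (by simp; omega)]
      have h1 : ¬ n < q := by omega
      have h2 : q < n := by omega
      have h3 : n ≠ q := by omega
      simp [ixd, h1, h2, h3]
  have f1 := h.add ((v - yy) - ((1 - 1 / Mu : ℝ) : 𝕜) • u) (ixd ε {q})
  have f2 := h.sub (v - yy) (((1 - 1 / Mu : ℝ) : 𝕜) • u)
  have f3 := h.sub v yy
  have hpos : 0 ≤ 1 - 1 / Mu := by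
    rw [sub_nonneg, div_le_one hMu0]; exact hMu
  have f4 := h.smul ((1 - 1 / Mu : ℝ) : 𝕜) u
  rw [RCLike.norm_ofReal, abs_of_nonneg hpos] at f4
  have f5 : N u ≤ K * (C * β) := hu.trans (mul_le_mul_of_nonneg_left hv2 (by linarith))
  have f6 := mul_le_mul_of_nonneg_left f5 hpos
  have f7 := ar4 hK1 hC1 hc0 h.c1 hcb
  rw [E]
  linarith

lemma case3 (h : Core 𝕜 w K C c M N) (s : Spt w M A B q) (he : ∀ n, ‖ε n‖ = 1)
    (he' : ∀ n, ‖ε' n‖ = 1) (hq : q ∈ A) (hqB : q ∈ B) (hee : ε q = ε' q) :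
    N (ixd ε A) ≤ K * C * ((1 + K) * C + c ^ 2) * N (ixd ε' B) := by
  have A0 := spl w A q
  have A1 := spl_lt w A q
  have A2 := spl_ge w A q
  have B0 := spl w B q
  have B1 := spl_lt w B q
  have B2 := spl_ge w B q
  rw [if_pos hq] at A1 A2
  rw [if_pos hqB] at B1 B2
  have s1 := s.h1
  have s2 := s.h2
  have s3 := s.hwt
  have a1p : 0 ≤ ∑ i ∈ A with i < q, w i := Finset.sum_nonneg (fun i _ => (h.hw i).le)
  have b2p : 0 ≤ ∑ i ∈ B with q + 1 ≤ i, w i := Finset.sum_nonneg (fun i _ => (h.hw i).le)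
  have key : ∀ H : Finset ℕ, H ⊆ A.filter (fun i => i < q) → ∀ n, ixd ε A n = ixd ε (A.filter (fun i => i < q)) n +
      (fun n => if q ≤ n ∧ n < q + 1 then (if n ∈ H then ε n else ixd ε' B n) else
        ixd ε (A.filter (fun i => q + 1 ≤ i)) n) n := by
    intro H hH n
    rcases lt_trichotomy n q with hh | hh | hh
    · have h1 : ¬ q ≤ n := by omega
      have h2 : ¬ q < n := by omega
      simp [ixd, h1, h2, hh]
    · subst hh
      have : n ∉ H := fun hh => by have := hH hh; simp at this
      simp [ixd, hq, hqB, hee, this]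
    · have h1 : ¬ n < q := by omega
      have h2 : q < n := by omega
      have h3 : ¬ n < q + 1 := by omega
      simp [ixd, h1, h2, h3]
  by_cases c1 : ∑ i ∈ A with q + 1 ≤ i, w i ≤ ∑ i ∈ B with i < q, w i
  · exact h.comb s he he' _ (h.LY (A := A.filter (fun i => q + 1 ≤ i)) (H := ∅) he he'
      ((Finset.filter_subset _ _).trans s.hA) s.hB (by simp) q (q + 1) (by omega)
      (by simp) (by simpa using b2p) (by simp) (by simpa using c1)) (key ∅ (by simp))
  by_cases c2 : ∑ i ∈ A with q + 1 ≤ i, w i ≤ ∑ i ∈ B ∪ A.filter (fun i => i < q) with i < q, w i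
  · exact h.comb s he he' _ (h.LY (A := A.filter (fun i => q + 1 ≤ i))
      (H := A.filter (fun i => i < q))
      he he' ((Finset.filter_subset _ _).trans s.hA) s.hB
      ((Finset.filter_subset _ _).trans s.hA) q (q + 1) (by omega)
      (by intro n hn; simp at hn; omega) (by linarith) (by simp) c2) (key _ (by simp))
  push Not at c1 c2
  have hy := h.LC (D := A.filter (fun i => q + 1 ≤ i)) (B := B)
    (L := B.filter (fun i => i < q) ∪ A.filter (fun i => i < q)) he he'
    ((Finset.filter_subset _ _).trans s.hA) s.hB
    (Finset.union_subset ((Finset.filter_subset _ _).trans s.hB)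
      ((Finset.filter_subset _ _).trans s.hA)) q (q + 1) (by omega) (by simp)
    (by intro n hn hn'; simp [hn, hn'])
    (by
      have t1 : (B \ A.filter (fun i => q + 1 ≤ i)).filter (fun i => i < q ∨ q + 1 ≤ i)
          = (B.erase q) \ A.filter (fun i => q + 1 ≤ i) := by
        ext i
        have : (i < q ∨ q + 1 ≤ i) ↔ i ≠ q := by omega
        simp only [Finset.mem_filter, Finset.mem_sdiff, Finset.mem_erase, this]
        tauto
      have t2 : A.filter (fun i => q + 1 ≤ i) \ B = A.filter (fun i => q + 1 ≤ i) \ B.erase q := by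
        ext i
        simp only [Finset.mem_filter, Finset.mem_sdiff, Finset.mem_erase]
        constructor
        · tauto
        · rintro ⟨⟨h1, h2⟩, h3⟩
          refine ⟨⟨h1, h2⟩, fun hh => h3 ⟨by omega, hh⟩⟩
      rw [t1, t2]
      have t3 := Finset.add_sum_erase B w hqB
      exact sd w _ _ (by linarith))
    (by
      have t1 : (B ∪ A.filter (fun i => i < q)).filter (fun i => i < q)
          = B.filter (fun i => i < q) ∪ A.filter (fun i => i < q) := by
        ext i; simp; tauto
      rw [t1] at c2
      exact c2.le)
    (ixd ε (A.filter (fun i => i < q)))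
    (by
      intro n
      by_cases hn : n ∈ A.filter (fun i => i < q) <;> simp only [ixd, hn, if_true, if_false, he] <;> simp)
    (by
      intro n hn
      simp only [Finset.mem_union, not_or] at hn
      simp only [ixd, hn, if_false])
  have hz := h.LZ' (A := A.filter (fun i => q + 1 ≤ i)) (G := B.filter (fun i => i < q + 1)) he he'
    ((Finset.filter_subset _ _).trans s.hA) s.hB (q + 1) (by simp)
    (Finset.filter_subset _ _) (by simp) (by linarith)
  set yy := (fun n => if n < q then ixd ε (A.filter (fun i => i < q)) n
      else if n < q + 1 then ixd ε' B n else 0) with hyy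
  have E : ixd ε A = yy + ixd ε (A.filter (fun i => q + 1 ≤ i)) := by
    ext n
    simp only [Pi.add_apply, hyy]
    rcases lt_trichotomy n q with hh | hh | hh
    · have h2 : ¬ q < n := by omega
      simp [ixd, h2, hh]
    · subst hh
      simp [ixd, hq, hqB, hee]
    · have h1 : ¬ n < q := by omega
      have h2 : q < n := by omega
      have h3 : ¬ n < q + 1 := by omega
      simp [ixd, h1, h2, h3]
  rw [E]
  have := h.add yy (ixd ε (A.filter (fun i => q + 1 ≤ i)))
  have := ar3 h.K1 h.C1 h.c1 (h.nonneg (ixd ε' B))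
  linarith

lemma case3' (h : Core 𝕜 w K C c M N) (s : Spt w M A B q) (he : ∀ n, ‖ε n‖ = 1)
    (he' : ∀ n, ‖ε' n‖ = 1) (hq : q ∈ A) (hqB : q ∈ B) :
    N (ixd ε A) ≤ K * C * ((1 + K) * C + c ^ 2) * N (ixd ε' B) := by
  have hne : ε q ≠ 0 := by
    intro hh
    have := he q
    simp [hh] at this
  have hth : ‖ε' q / ε q‖ = 1 := by simp [he, he']
  have := h.case3 (ε := fun n => ε' q / ε q * ε n) s (by intro n; rw [norm_mul, hth, he, one_mul])
    he' hq hqB (by field_simp)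
  have e : ixd (fun n => ε' q / ε q * ε n) A = (ε' q / ε q) • ixd ε A := by
    ext n
    simp [ixd]
  rw [e, h.smul, hth, one_mul] at this
  exact this
end

theorem main (h : Core 𝕜 w K C c M N) {A B : Finset ℕ} {ε ε' : ℕ → 𝕜} (he : ∀ n, ‖ε n‖ = 1)
    (he' : ∀ n, ‖ε' n‖ = 1) (hA : A ⊆ Finset.range M) (hB : B ⊆ Finset.range M)
    (hwt : ∑ i ∈ A, w i ≤ ∑ i ∈ B, w i) :
    N (ixd ε A) ≤ K * C * ((1 + K) * C + c ^ 2) * N (ixd ε' B) := by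
  have hK1 := h.K1
  have hC1 := h.C1
  classical
  by_cases hA0 : A = ∅
  · have e : ixd ε A = (0 : 𝕜) • ixd ε A := by
      ext n; simp [ixd, hA0]
    rw [e, h.smul]
    have := h.nonneg (ixd ε' B)
    simp only [norm_zero, zero_mul]
    positivity
  have hex : ∃ m, ∑ i ∈ B, w i < ∑ i ∈ A with i < m, w i + ∑ i ∈ B with i < m, w i := by
    refine ⟨M, ?_⟩
    rw [Finset.filter_true_of_mem (fun i hi => Finset.mem_range.1 (hA hi)),
      Finset.filter_true_of_mem (fun i hi => Finset.mem_range.1 (hB hi))]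
    have : 0 < ∑ i ∈ A, w i :=
      Finset.sum_pos (fun i _ => h.hw i) (Finset.nonempty_iff_ne_empty.2 hA0)
    linarith
  have hm := Nat.find_spec hex
  have hm' := fun k (hk : k < Nat.find hex) => Nat.find_min hex hk
  rcases hq : Nat.find hex with _ | q
  · rw [hq] at hm
    simp at hm
    have : 0 ≤ ∑ i ∈ B, w i := Finset.sum_nonneg (fun i _ => (h.hw i).le)
    linarith
  · rw [hq] at hm hm'
    have s : Spt w M A B q := ⟨hA, hB, hwt, not_lt.1 (hm' q (by omega)), hm⟩
    by_cases h1 : q ∈ A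
    · by_cases h2 : q ∈ B
      · exact h.case3' s he he' h1 h2
      · exact h.case2 s he he' h1 h2
    · exact h.case1 s he he' h1

end Core

section inst
variable {𝕜 : Type*} [RCLike 𝕜] {X : Type*} [NormedAddCommGroup X] [NormedSpace 𝕜 X]

lemma mb_f_sum (b : MBasis 𝕜 X) (S : Finset ℕ) (a : ℕ → 𝕜) (n : ℕ) :
    b.f n (∑ i ∈ S, a i • b.e i) = if n ∈ S then a n else 0 := by
  simp [map_sum, b.biorth]

lemma mb_K1 (b : MBasis 𝕜 X) {K : ℝ} (hS : b.SchauderConst K) : 1 ≤ K := by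
  have h1 := hS 1 (b.e 0)
  simp [b.biorth] at h1
  have : 0 < ‖b.e 0‖ := lt_of_lt_of_le b.c₁_pos (b.c₁_le_e 0)
  by_contra hh
  push Not at hh
  nlinarith

lemma mb_C1 (b : MBasis 𝕜 X) {w : ℕ → ℝ} {C : ℝ} (h : b.WSemiGreedy w C) : 1 ≤ C := by
  obtain ⟨z, hz, h1⟩ := h (b.e 0) ∅ (by intro n hn; simp at hn) ∅ le_rfl 0
  simp at hz h1
  subst hz
  have : 0 < ‖b.e 0‖ := lt_of_lt_of_le b.c₁_pos (b.c₁_le_e 0)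
  by_contra hh
  push Not at hh
  simp at h1
  nlinarith

lemma mb_c0 (b : MBasis 𝕜 X) : 0 < b.c₂ :=
  lt_of_lt_of_le b.c₁_pos ((b.c₁_le_e 0).trans (b.e_le_c₂ 0))

lemma mb_c1 (b : MBasis 𝕜 X) : 1 ≤ b.c₂ ^ 2 := by
  have h1 := (b.f 0).le_opNorm (b.e 0)
  rw [b.biorth] at h1
  simp at h1
  have h2 := b.e_le_c₂ 0
  have h3 := b.f_le_c₂ 0
  have : ‖b.f 0‖ * ‖b.e 0‖ ≤ b.c₂ * b.c₂ := mul_le_mul h3 h2 (norm_nonneg _) (mb_c0 b).le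
  nlinarith

lemma mb_span (b : MBasis 𝕜 X) (L : Finset ℕ) (z : X)
    (hz : z ∈ Submodule.span 𝕜 (b.e '' (L : Set ℕ))) :
    z = ∑ n ∈ L, b.f n z • b.e n := by
  induction hz using Submodule.span_induction with
  | mem x hx =>
    obtain ⟨i, hi, rfl⟩ := hx
    have hi' : i ∈ L := hi
    simp [b.biorth, hi']
  | zero => simp
  | add x y _ _ hx hy =>
    simp only [map_add, add_smul, Finset.sum_add_distrib]
    rw [← hx, ← hy]
  | smul t x _ hx =>
    simp only [map_smul, smul_eq_mul, mul_smul, ← Finset.smul_sum]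
    rw [← hx]

lemma mb_sub {b : MBasis 𝕜 X} {S : Finset ℕ} {M : ℕ} (hS : S ⊆ Finset.range M) (a : ℕ → 𝕜) :
    ∑ n ∈ S, a n • b.e n = ∑ n ∈ Finset.range M, (if n ∈ S then a n else 0) • b.e n := by
  simp only [ite_smul, zero_smul]
  rw [← Finset.sum_filter]
  congr 1
  ext i
  simp only [Finset.mem_filter]
  exact ⟨fun h => ⟨hS h, h⟩, fun h => h.2⟩

lemma mb_core (b : MBasis 𝕜 X) {w : ℕ → ℝ} (hw : ∀ n, 0 < w n) {K C : ℝ}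
    (hS : b.SchauderConst K) (h : b.WSemiGreedy w C) (M : ℕ) :
    Core 𝕜 w K C b.c₂ M (fun a => ‖∑ n ∈ Finset.range M, a n • b.e n‖) where
  hw := hw
  K1 := mb_K1 b hS
  C1 := mb_C1 b h
  c0 := mb_c0 b
  c1 := mb_c1 b
  add a d := by
    simp only [Pi.add_apply, add_smul, Finset.sum_add_distrib]
    exact norm_add_le _ _
  smul t a := by
    simp only [Pi.smul_apply, smul_eq_mul, mul_smul, ← Finset.smul_sum, norm_smul]
  cut a m := by
    refine le_trans (le_of_eq ?_) (hS m (∑ n ∈ Finset.range M, a n • b.e n))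
    congr 1
    simp only [mb_f_sum, ite_smul, zero_smul]
    rw [← Finset.sum_filter, ← Finset.sum_filter]
    congr 1
    ext i
    simp [and_comm]
  coef a n hn := by
    have h1 := (b.f n).le_opNorm (∑ n ∈ Finset.range M, a n • b.e n)
    rw [mb_f_sum, if_pos (Finset.mem_range.2 hn)] at h1
    exact h1.trans (mul_le_mul_of_nonneg_right (b.f_le_c₂ n) (norm_nonneg _))
  unit a q h0 h1 := by
    by_cases hq : q ∈ Finset.range M
    · rw [Finset.sum_eq_single_of_mem q hq (fun n _ hn => by simp [h0 n hn]), norm_smul, h1, one_mul]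
      exact b.e_le_c₂ q
    · rw [Finset.sum_eq_zero (fun n hn => by
        rw [h0 n (fun hh => hq (hh ▸ hn)), zero_smul]), norm_zero]
      exact (mb_c0 b).le
  sg a d L S t hL hSM hwt h1 h2 h3 := by
    obtain ⟨z, hz, h4⟩ := h (∑ n ∈ Finset.range M, a n • b.e n) L
      (by
        intro n hn k hk
        rw [mb_f_sum, mb_f_sum, if_pos (hL hn)]
        split_ifs
        · exact (h2 k hk).trans (h1 n hn)
        · simp)
      S hwt (fun n => a n - d n)
    refine ⟨fun n => a n - if n ∈ L then b.f n z else 0, ?_, ?_⟩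
    · intro n hn; simp [hn]
    · have e1 : ∑ n ∈ Finset.range M, (a n - if n ∈ L then b.f n z else 0) • b.e n
          = ∑ n ∈ Finset.range M, a n • b.e n - z := by
        conv_rhs => rw [mb_span b L z hz, mb_sub hL]
        simp only [sub_smul, Finset.sum_sub_distrib]
      have e2 : ∑ n ∈ Finset.range M, d n • b.e n
          = ∑ n ∈ Finset.range M, a n • b.e n - ∑ n ∈ S, (a n - d n) • b.e n := by
        rw [mb_sub hSM (fun n => a n - d n), ← Finset.sum_sub_distrib]
        refine Finset.sum_congr rfl fun n _ => ?_
        rw [← sub_smul]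
        by_cases hn : n ∈ S
        · simp [hn]
        · simp [hn, h3 n hn]
      simp only []
      rw [e1, e2]
      exact h4

lemma mb_super (b : MBasis 𝕜 X) {w : ℕ → ℝ} (hw : ∀ n, 0 < w n) {K C : ℝ}
    (hS : b.SchauderConst K) (h : b.WSemiGreedy w C) :
    b.WSuperDemocratic w (K * C * ((1 + K) * C + b.c₂ ^ 2)) := by
  intro A B hwt ε ε' he he'
  obtain ⟨M, hM⟩ : ∃ M, ∀ i ∈ A ∪ B, i < M :=
    ⟨(A ∪ B).sup id + 1, fun i hi => Nat.lt_succ_of_le (Finset.le_sup (f := id) hi)⟩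
  have hA : A ⊆ Finset.range M := fun i hi => Finset.mem_range.2 (hM i (by simp [hi]))
  have hB : B ⊆ Finset.range M := fun i hi => Finset.mem_range.2 (hM i (by simp [hi]))
  have := (mb_core b hw hS h M).main he he' hA hB hwt
  unfold MBasis.indic
  rw [mb_sub hA, mb_sub hB]
  exact this

lemma proj_f (b : MBasis 𝕜 X) (S : Finset ℕ) (x : X) (n : ℕ) :
    b.f n (b.proj S x) = if n ∈ S then b.f n x else 0 := mb_f_sum b S _ n

/-- one application of semi-greediness -/
lemma mb_step (b : MBasis 𝕜 X) {w : ℕ → ℝ} {C : ℝ} (h : b.WSemiGreedy w C) (x : X)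
    (L1 L2 : Finset ℕ) (hd : Disjoint L1 L2) (hg : b.IsGreedySet x (L1 ∪ L2))
    (hwt : ∑ i ∈ L1, w i ≤ ∑ i ∈ L2, w i) :
    ∃ y, ‖y‖ ≤ C * ‖x‖ ∧ ∀ n, n ∉ L2 → b.f n y = if n ∈ L1 then 0 else b.f n x := by
  obtain ⟨z, hz, h1⟩ := h (x - b.proj L1 x) L2
    (by
      intro n hn k hk
      have hn1 : n ∉ L1 := fun hh => Finset.disjoint_left.1 hd hh hn
      rw [map_sub, map_sub, proj_f, proj_f, if_neg hn1, sub_zero]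
      by_cases hk1 : k ∈ L1
      · simp [hk1]
      · rw [if_neg hk1, sub_zero]
        exact hg n (by simp [hn]) k (by simp [hk, hk1]))
    L1 hwt (fun n => - b.f n x)
  refine ⟨x - b.proj L1 x - z, ?_, ?_⟩
  · have : x - b.proj L1 x - ∑ n ∈ L1, (- b.f n x) • b.e n = x := by
      simp [MBasis.proj]
    rwa [this] at h1
  · intro n hn
    have hz0 : b.f n z = 0 := by
      rw [mb_span b L2 z hz, mb_f_sum, if_neg hn]
    rw [map_sub, map_sub, hz0, proj_f]
    split_ifs <;> simp

lemma mb_quasi (b : MBasis 𝕜 X) {w : ℕ → ℝ} (hw : ∀ n, 0 < w n) {K C : ℝ}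
    (hS : b.SchauderConst K) (h : b.WSemiGreedy w C) :
    b.QuasiGreedy (C * K * (1 + (1 + K) * C + b.c₂ ^ 2)) := by
  intro x Λ hg
  have hK := mb_K1 b hS
  have hC := mb_C1 b h
  have hc := mb_c1 b
  have hx := norm_nonneg x
  have hCK : 1 ≤ C * K := by nlinarith
  have hbig : (1 + 2 * K) * C ≤ C * K * (1 + (1 + K) * C + b.c₂ ^ 2) := by
    have h0 : 0 ≤ C * K := by linarith
    have h1 : (1 + K) * 1 ≤ (1 + K) * C := mul_le_mul_of_nonneg_left hC (by linarith)
    have h2 : C * K * (1 + (1 + K) * 1 + 1) ≤ C * K * (1 + (1 + K) * C + b.c₂ ^ 2) :=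
      mul_le_mul_of_nonneg_left (by linarith) h0
    nlinarith
  have main : ‖x - b.proj Λ x‖ ≤ (1 + 2 * K) * C * ‖x‖ := by
    by_cases hΛ : Λ = ∅
    · subst hΛ
      have : x - b.proj ∅ x = x := by simp [MBasis.proj]
      rw [this]
      have : 1 ≤ (1 + 2 * K) * C := by nlinarith
      nlinarith
    have hex : ∃ m, ∑ i ∈ Λ with m ≤ i, w i < ∑ i ∈ Λ with i < m, w i := by
      refine ⟨Λ.sup id + 1, ?_⟩
      have h1 : ∀ i ∈ Λ, i < Λ.sup id + 1 := fun i hi =>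
        Nat.lt_succ_of_le (Finset.le_sup (f := id) hi)
      rw [Finset.filter_true_of_mem h1, Finset.filter_false_of_mem (fun i hi => by
        have := h1 i hi; omega)]
      rw [Finset.sum_empty]
      exact Finset.sum_pos (fun i _ => hw i) (Finset.nonempty_iff_ne_empty.2 hΛ)
    have hm := Nat.find_spec hex
    have hm' := fun k (hk : k < Nat.find hex) => Nat.find_min hex hk
    rcases hq : Nat.find hex with _ | q
    · rw [hq] at hm
      simp at hm
      have : 0 ≤ ∑ i ∈ Λ, w i := Finset.sum_nonneg (fun i _ => (hw i).le)
      linarith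
    rw [hq] at hm hm'
    have hm'' := not_lt.1 (hm' q (by omega))
    have hqΛ : q ∈ Λ := by
      by_contra hh
      have h1 := Core.spl_lt w Λ q
      have h2 := Core.spl_ge w Λ q
      rw [if_neg hh] at h1 h2
      linarith
    have hu1 : ∀ m, Λ.filter (fun i => i < m) ∪ Λ.filter (fun i => m ≤ i) = Λ := by
      intro m; ext i
      simp only [Finset.mem_union, Finset.mem_filter]
      have := lt_or_ge i m
      tauto
    have hdj : ∀ m, Disjoint (Λ.filter (fun i => i < m)) (Λ.filter (fun i => m ≤ i)) := by
      intro m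
      rw [Finset.disjoint_left]
      intro i hi hi'
      simp only [Finset.mem_filter] at hi hi'
      omega
    obtain ⟨y1, hy1, hy1'⟩ := mb_step b h x _ _ (hdj q) (by rw [hu1]; exact hg) hm''
    obtain ⟨y2, hy2, hy2'⟩ := mb_step b h x _ _ (hdj (q + 1)).symm
      (by rw [Finset.union_comm, hu1]; exact hg) hm.le
    have t1 := hS q y1
    have t2 := hS (q + 1) y2
    have E : x - b.proj Λ x = (∑ j ∈ Finset.range q, b.f j y1 • b.e j)
        + (y2 - ∑ j ∈ Finset.range (q + 1), b.f j y2 • b.e j) := by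
      rw [← sub_eq_zero]
      apply b.total
      intro n
      rw [map_sub, map_sub, map_add, map_sub, proj_f, mb_f_sum, mb_f_sum]
      simp only [Finset.mem_range]
      rcases lt_trichotomy n q with hh | hh | hh
      · have h1 : n < q + 1 := by omega
        have h2 : ¬ q ≤ n := by omega
        rw [if_pos hh, if_pos h1, hy1' n (by simp [h2])]
        by_cases hn : n ∈ Λ <;> simp [hn, hh]
      · subst hh
        simp [hqΛ]
      · have h1 : ¬ n < q + 1 := by omega
        have h2 : ¬ n < q := by omega
        rw [if_neg h2, if_neg h1, hy2' n (by simp; omega)]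
        by_cases hn : n ∈ Λ <;> simp [hn, hh]
    rw [E]
    have n1 := norm_add_le (∑ j ∈ Finset.range q, b.f j y1 • b.e j)
      (y2 - ∑ j ∈ Finset.range (q + 1), b.f j y2 • b.e j)
    have n2 := norm_sub_le y2 (∑ j ∈ Finset.range (q + 1), b.f j y2 • b.e j)
    have n3 := mul_le_mul_of_nonneg_left hy1 (by linarith : (0:ℝ) ≤ K)
    have n4 := mul_le_mul_of_nonneg_left hy2 (by linarith : (0:ℝ) ≤ K)
    nlinarith
  exact main.trans (mul_le_mul_of_nonneg_right hbig hx)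

end inst

/-- If a Schauder basis with basis constant `𝔎_b` is `C_sg`-`w`-semi-greedy, then it is
quasi-greedy with constant at most `C_sg 𝔎_b (1 + (1 + 𝔎_b) C_sg + c₂²)` and
`w`-super-democratic with constant at most `𝔎_b C_sg ((1 + 𝔎_b) C_sg + c₂²)`. -/
theorem stmt2 (b : MBasis 𝕜 X) (w : ℕ → ℝ) (hw : ∀ n, 0 < w n) (Kb Csg : ℝ)
    (hSch : b.SchauderConst Kb) (h : b.WSemiGreedy w Csg) :
    b.QuasiGreedy (Csg * Kb * (1 + (1 + Kb) * Csg + b.c₂ ^ 2)) ∧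
      b.WSuperDemocratic w (Kb * Csg * ((1 + Kb) * Csg + b.c₂ ^ 2)) := by
  exact ⟨mb_quasi b hw hSch h, mb_super b hw hSch h⟩
end
end

section
/- Let B be a Schauder basis of a Banach space X over 𝔽 and let w be a weight. If B is C_q-quasi-greedy and C_s-w-super-democratic, then B is C_sg-w-semi-greedy with C_sg ≤ C_q + 4C_qC_s. -/
open scoped BigOperators NNReal

noncomputable section

variable {𝕜 : Type*} [RCLike 𝕜] {X : Type*} [NormedAddCommGroup X] [NormedSpace 𝕜 X]
  [CompleteSpace X]

open MBasis

namespace Stmt3Aux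

lemma layer_cake {Y : Type*} [NormedAddCommGroup Y] [NormedSpace ℝ Y]
    [CompleteSpace Y] (G : Finset ℕ) (l : ℕ → ℝ) (hl0 : ∀ n ∈ G, 0 ≤ l n)
    (hl1 : ∀ n ∈ G, l n ≤ 1) (g : ℕ → Y) (y : Y) (M : ℝ)
    (h : ∀ s : ℝ, 0 ≤ s → ‖y - ∑ n ∈ G with s < l n, g n‖ ≤ M) :
    ‖y - ∑ n ∈ G, l n • g n‖ ≤ M := by
  have hint : ∀ n ∈ G, IntervalIntegrable (fun s : ℝ => if s < l n then g n else 0)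
      MeasureTheory.volume 0 1 := by
    intro n _
    rw [intervalIntegrable_iff]
    have : (fun s : ℝ => if s < l n then g n else 0)
        = Set.indicator (Set.Iio (l n)) (fun _ => g n) := by
      ext s; simp [Set.indicator]
    rw [this]
    apply MeasureTheory.IntegrableOn.indicator _ measurableSet_Iio
    simp
  have hval : ∀ n ∈ G, (∫ s in (0:ℝ)..1, (if s < l n then g n else 0)) = l n • g n := by
    intro n hn
    have : (fun s : ℝ => if s < l n then g n else 0)
        = Set.indicator (Set.Iio (l n)) (fun _ => g n) := by
      ext s; simp [Set.indicator]
    rw [this, intervalIntegral.integral_of_le zero_le_one,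
      MeasureTheory.integral_Ioc_eq_integral_Ioo,
      MeasureTheory.setIntegral_indicator measurableSet_Iio]
    have : Set.Ioo (0:ℝ) 1 ∩ Set.Iio (l n) = Set.Ioo 0 (l n) := by
      have := hl1 n hn
      ext s; simp; grind
    rw [this]
    simp [hl0 n hn]
  have key : y - ∑ n ∈ G, l n • g n
      = ∫ s in (0:ℝ)..1, (y - ∑ n ∈ G with s < l n, g n) := by
    simp_rw [Finset.sum_filter]
    rw [intervalIntegral.integral_sub (by simp), intervalIntegral.integral_finsetSum hint,
      Finset.sum_congr rfl hval]
    · simp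
    · have := IntervalIntegrable.sum G hint
      have e : (fun s : ℝ => ∑ n ∈ G, if s < l n then g n else 0)
          = ∑ n ∈ G, fun s : ℝ => if s < l n then g n else 0 := by
        funext s; simp
      rw [e]
      exact this
  rw [key]
  have := intervalIntegral.norm_integral_le_of_norm_le_const (a := (0:ℝ)) (b := 1) (C := M)
    (f := fun s => (y - ∑ n ∈ G with s < l n, g n)) (by
      intro s hs
      rw [Set.uIoc_of_le zero_le_one] at hs
      exact h s hs.1.le)
  simpa using this

variable {𝕜 : Type*} [RCLike 𝕜] {X : Type*} [NormedAddCommGroup X] [NormedSpace 𝕜 X]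

lemma layer_cake' [CompleteSpace X] (G : Finset ℕ) (l : ℕ → ℝ) (hl0 : ∀ n ∈ G, 0 ≤ l n)
    (hl1 : ∀ n ∈ G, l n ≤ 1) (g : ℕ → X) (y : X) (M : ℝ)
    (h : ∀ s : ℝ, 0 ≤ s → ‖y - ∑ n ∈ G with s < l n, g n‖ ≤ M) :
    ‖y - ∑ n ∈ G, (l n : 𝕜) • g n‖ ≤ M := by
  letI := NormedSpace.restrictScalars ℝ 𝕜 X
  exact layer_cake G l hl0 hl1 g y M h

lemma exists_sign (c : 𝕜) : ∃ s : 𝕜, ‖s‖ = 1 ∧ c = (‖c‖ : 𝕜) * s := by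
  by_cases hc : c = 0
  · exact ⟨1, by simp, by simp [hc]⟩
  · have : (‖c‖ : 𝕜) ≠ 0 := by simpa using hc
    refine ⟨c / (‖c‖ : 𝕜), ?_, by field_simp⟩
    rw [norm_div]; simp [hc]

lemma sign_convex (b : MBasis 𝕜 X) (A : Finset ℕ) : ∀ (y : X) (M : ℝ),
    (∀ ε : ℕ → 𝕜, IsSign ε → ‖y + b.indic ε A‖ ≤ M) →
    ∀ c : ℕ → 𝕜, (∀ n ∈ A, ‖c n‖ ≤ 1) → ‖y + ∑ n ∈ A, c n • b.e n‖ ≤ M := by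
  classical
  induction A using Finset.induction_on with
  | empty =>
    intro y M h c _
    simpa [indic] using h (fun _ => 1) (fun _ => by simp)
  | insert a A ha ih =>
    intro y M h c hc
    have step : ∀ s : 𝕜, ‖s‖ = 1 → ‖(y + s • b.e a) + ∑ n ∈ A, c n • b.e n‖ ≤ M := by
      intro s hs
      apply ih _ M _ c (fun n hn => hc n (Finset.mem_insert_of_mem hn))
      intro ε hε
      have := h (Function.update ε a s) (by
        intro n
        by_cases hn : n = a
        · subst hn; simpa using hs
        · simpa [hn] using hε n)
      rw [indic, Finset.sum_insert ha] at this
      have e2 : ∑ n ∈ A, Function.update ε a s n • b.e n = b.indic ε A := by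
        apply Finset.sum_congr rfl
        intro n hn
        have : n ≠ a := fun h => ha (h ▸ hn)
        simp [this]
      rw [e2] at this
      simpa [add_assoc] using this
    obtain ⟨s, hs, hcs⟩ := exists_sign (c a)
    have h1 := step s hs
    have h2 := step (-s) (by simpa using hs)
    have hca := hc a (Finset.mem_insert_self _ _)
    rw [Finset.sum_insert ha]
    set r := ‖c a‖
    set S := ∑ n ∈ A, c n • b.e n
    have e : y + (c a • b.e a + S) = (((1 + r) / 2 : ℝ) : 𝕜) • (y + s • b.e a + S)
        + (((1 - r) / 2 : ℝ) : 𝕜) • (y + -s • b.e a + S) := by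
      rw [hcs]
      push_cast
      module
    have hr0 : 0 ≤ r := norm_nonneg _
    rw [e]
    calc _ ≤ _ := norm_add_le _ _
      _ = (1 + r) / 2 * ‖y + s • b.e a + S‖ + (1 - r) / 2 * ‖y + -s • b.e a + S‖ := by
        rw [norm_smul, norm_smul, RCLike.norm_ofReal, RCLike.norm_ofReal,
          abs_of_nonneg (by linarith), abs_of_nonneg (by linarith)]
      _ ≤ (1 + r) / 2 * M + (1 - r) / 2 * M := by
        gcongr
      _ = M := by ring

lemma f_sum (b : MBasis 𝕜 X) (A : Finset ℕ) (c : ℕ → 𝕜) (k : ℕ) :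
    b.f k (∑ n ∈ A, c n • b.e n) = if k ∈ A then c k else 0 := by
  simp [map_sum, b.biorth]

lemma finite_large (b : MBasis 𝕜 X) (y : X) (t : ℝ) (ht : 0 < t) :
    {n | t ≤ ‖b.f n y‖}.Finite := by
  have hc2 : 0 < b.c₂ := b.c₁_pos.trans_le ((b.c₁_le_e 0).trans (b.e_le_c₂ 0))
  have hy : y ∈ closure (Submodule.span 𝕜 (Set.range b.e) : Set X) := by
    rw [b.dense_span]; trivial
  obtain ⟨u, hu, hd⟩ := Metric.mem_closure_iff.1 hy (t / b.c₂) (by positivity)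
  have hfin : {n | b.f n u ≠ 0}.Finite := by
    have hu' : u ∈ Submodule.span 𝕜 (Set.range b.e) := hu
    clear hd hu
    induction hu' using Submodule.span_induction with
    | mem x hx =>
      obtain ⟨i, rfl⟩ := hx
      apply (Set.finite_singleton i).subset
      intro n hn
      simp [b.biorth] at hn
      simpa using hn
    | zero => simp
    | add x y _ _ h1 h2 =>
      apply (h1.union h2).subset
      intro n hn
      by_contra hh
      simp at hh hn
      simp [hh.1, hh.2] at hn
    | smul a x _ h1 =>
      apply h1.subset
      intro n hn
      simp at hn ⊢
      exact hn.2
  apply hfin.subset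
  intro n hn h0
  have h1 : ‖b.f n (y - u)‖ ≤ b.c₂ * ‖y - u‖ :=
    ((b.f n).le_opNorm _).trans (by gcongr; exact b.f_le_c₂ n)
  rw [map_sub, h0, sub_zero] at h1
  rw [dist_eq_norm, lt_div_iff₀ hc2] at hd
  have : t ≤ ‖b.f n y‖ := hn
  linarith

lemma mem_span (b : MBasis 𝕜 X) (Λ : Finset ℕ) (z : X) (h : ∀ k, k ∉ Λ → b.f k z = 0) :
    z ∈ Submodule.span 𝕜 (b.e '' (Λ : Set ℕ)) := by
  have : z - ∑ n ∈ Λ, b.f n z • b.e n = 0 := by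
    apply b.total
    intro j
    rw [map_sub, f_sum]
    split_ifs with hj
    · simp
    · simp [h j hj]
  rw [sub_eq_zero.1 this]
  apply Submodule.sum_mem
  intro n hn
  exact Submodule.smul_mem _ _ (Submodule.subset_span ⟨n, hn, rfl⟩)

end Stmt3Aux

/-- For a Schauder basis, quasi-greedy plus `w`-super-democratic implies
`w`-semi-greedy with constant `C_q + 4 C_q C_s`. -/
theorem stmt3 (b : MBasis 𝕜 X) (w : ℕ → ℝ) (hw : ∀ n, 0 < w n) (Cq Cs : ℝ)
    (hSch : ∃ K : ℝ, b.SchauderConst K)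
    (hq : b.QuasiGreedy Cq) (hs : b.WSuperDemocratic w Cs) :
    b.WSemiGreedy w (Cq + 4 * Cq * Cs) := by
  classical
  have he0 : 0 < ‖b.e 0‖ := b.c₁_pos.trans_le (b.c₁_le_e 0)
  have hCq : 1 ≤ Cq := by
    have := hq (b.e 0) ∅ (by intro n hn; simp at hn)
    simp only [proj, Finset.sum_empty, sub_zero] at this
    by_contra hh
    nlinarith
  have hCs : 1 ≤ Cs := by
    have := hs {0} {0} le_rfl (fun _ => 1) (fun _ => 1) (fun _ => by simp) (fun _ => by simp)
    simp only [indic, Finset.sum_singleton, one_smul] at this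
    by_contra hh
    nlinarith
  have hCC : 0 ≤ Cq * Cs := by positivity
  intro x Λ hΛ A hA a
  set y := x - ∑ n ∈ A, a n • b.e n with hy
  have hfy : ∀ k, k ∉ A → b.f k y = b.f k x := by
    intro k hk
    rw [hy, map_sub, Stmt3Aux.f_sum, if_neg hk, sub_zero]
  rcases Λ.eq_empty_or_nonempty with rfl | hne
  · have hAe : A = ∅ := by
      by_contra hne
      have : 0 < ∑ i ∈ A, w i := Finset.sum_pos (fun i _ => hw i) (Finset.nonempty_iff_ne_empty.2 hne)
      simp only [wSum, Finset.sum_empty] at hA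
      linarith
    refine ⟨0, Submodule.zero_mem _, ?_⟩
    have : y = x := by simp [hy, hAe]
    rw [this, sub_zero]
    nlinarith [norm_nonneg x]
  obtain ⟨m, hm, hmin⟩ := Finset.exists_min_image Λ (fun n => ‖b.f n x‖) hne
  set t := ‖b.f m x‖ with ht
  have hout : ∀ k, k ∉ Λ → ‖b.f k x‖ ≤ t := fun k hk => hΛ m hm k hk
  rcases (norm_nonneg (b.f m x)).eq_or_lt with h0 | htpos
  · refine ⟨x, Stmt3Aux.mem_span b Λ x ?_, ?_⟩
    · intro k hk
      have := hout k hk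
      rw [ht, ← h0] at this
      simpa using this
    · rw [sub_self, norm_zero]
      have : 0 ≤ Cq + 4 * Cq * Cs := by nlinarith
      positivity
  rw [← ht] at htpos
  set G := (Stmt3Aux.finite_large b y t htpos).toFinset with hG
  have memG : ∀ n, n ∈ G ↔ t ≤ ‖b.f n y‖ := by intro n; simp [hG]
  have posG : ∀ n, n ∈ G → 0 < ‖b.f n y‖ := fun n hn => htpos.trans_le ((memG n).1 hn)
  set l : ℕ → ℝ := fun n => 1 - t / ‖b.f n y‖ with hl
  set T := y - ∑ n ∈ G, ((l n : 𝕜) * b.f n y) • b.e n with hT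
  have hTn : ‖T‖ ≤ Cq * ‖y‖ := by
    have := Stmt3Aux.layer_cake' (𝕜 := 𝕜) G l (by
      intro n hn
      have := (div_le_one (posG n hn)).2 ((memG n).1 hn)
      simp only [hl]; linarith) (by
      intro n hn
      have : 0 ≤ t / ‖b.f n y‖ := by positivity
      simp only [hl]; linarith) (fun n => b.f n y • b.e n) y (Cq * ‖y‖) (by
      intro s hs0
      apply hq
      intro n hn k hk
      simp only [Finset.mem_filter] at hn hk
      have h1 := (memG n).1 hn.1
      by_cases hkG : k ∈ G
      · have h2 : l k < l n := by
          have : ¬ s < l k := fun h => hk ⟨hkG, h⟩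
          linarith [hn.2]
        simp only [hl] at h2
        by_contra hlt
        push Not at hlt
        have := div_le_div_of_nonneg_left htpos.le (posG n hn.1) hlt.le
        linarith
      · have := mt (memG k).2 hkG
        linarith)
    simpa only [hT, smul_smul] using this
  have hfT : ∀ k, b.f k T = if k ∈ G then ((t / ‖b.f k y‖ : ℝ) : 𝕜) * b.f k y else b.f k y := by
    intro k
    rw [hT, map_sub, Stmt3Aux.f_sum]
    split_ifs
    · simp only [hl]; push_cast; ring
    · simp
  have hfTle : ∀ k, ‖b.f k T‖ ≤ t := by
    intro k
    rw [hfT]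
    split_ifs with hk
    · have := posG k hk
      rw [norm_mul, RCLike.norm_ofReal, abs_of_nonneg (by positivity)]
      exact (div_mul_cancel₀ _ this.ne').le
    · have := mt (memG k).2 hk
      linarith
  set ε : ℕ → 𝕜 := fun n => if n ∈ G then b.f n y / (‖b.f n y‖ : 𝕜) else 1 with hε
  have hεs : IsSign ε := by
    intro n
    simp only [hε]
    split_ifs with hn
    · have := posG n hn
      rw [norm_div, RCLike.norm_ofReal, abs_of_pos this, div_self this.ne']
    · simp
  have hGn : t * ‖b.indic ε G‖ ≤ 2 * Cq * ‖y‖ := by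
    have e1 : (t : 𝕜) • b.indic ε G = T - (y - b.proj G y) := by
      rw [hT, indic, proj, Finset.smul_sum, sub_sub_sub_cancel_left, ← Finset.sum_sub_distrib]
      apply Finset.sum_congr rfl
      intro n hn
      rw [smul_smul, ← sub_smul]
      congr 1
      simp only [hε, hl, if_pos hn]
      push_cast
      ring
    have e2 : ‖(t : 𝕜) • b.indic ε G‖ = t * ‖b.indic ε G‖ := by
      rw [norm_smul, RCLike.norm_ofReal, abs_of_pos htpos]
    rw [← e2, e1]
    have h3 := hq y G (by
      intro n hn k hk
      have h1 := (memG n).1 hn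
      have := mt (memG k).2 hk
      linarith)
    have := norm_sub_le T (y - b.proj G y)
    linarith
  have hwt : wSum w (A \ Λ) ≤ wSum w G := by
    have h1 : wSum w (Λ \ A) ≤ wSum w G := by
      apply Finset.sum_le_sum_of_subset_of_nonneg
      · intro n hn
        rw [Finset.mem_sdiff] at hn
        rw [memG, hfy n hn.2]
        exact hmin n hn.1
      · intro i _ _; exact (hw i).le
    have h2 := Finset.sum_inter_add_sum_sdiff A Λ w
    have h3 := Finset.sum_inter_add_sum_sdiff Λ A w
    rw [Finset.inter_comm] at h3
    simp only [wSum] at *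
    linarith
  set c : ℕ → 𝕜 := fun n => (b.f n x - b.f n T) / ((2 * t : ℝ) : 𝕜) with hc
  have hcle : ∀ n ∈ A \ Λ, ‖c n‖ ≤ 1 := by
    intro n hn
    simp only [hc]
    rw [norm_div, RCLike.norm_ofReal, abs_of_pos (by positivity), div_le_one (by positivity)]
    have h1 := hout n (Finset.mem_sdiff.1 hn).2
    have := norm_sub_le (b.f n x) (b.f n T)
    linarith [hfTle n]
  have hD := Stmt3Aux.sign_convex b (A \ Λ) 0 (Cs * ‖b.indic ε G‖) (by
    intro ε' hε'
    rw [zero_add]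
    exact hs _ _ hwt _ _ hε' hεs) c hcle
  rw [zero_add] at hD
  set D := ∑ n ∈ A \ Λ, c n • b.e n with hDdef
  have h2t : ((2 * t : ℝ) : 𝕜) ≠ 0 := by
    have : (2 * t : ℝ) ≠ 0 := by positivity
    exact_mod_cast this
  refine ⟨x - (T + ((2 * t : ℝ) : 𝕜) • D), Stmt3Aux.mem_span b Λ _ ?_, ?_⟩
  · intro k hk
    rw [map_sub, map_add, map_smul, hDdef, Stmt3Aux.f_sum]
    split_ifs with hkA
    · simp only [hc, smul_eq_mul]
      rw [mul_div_cancel₀ _ h2t]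
      ring
    · have hkA' : k ∉ A := fun h => hkA (Finset.mem_sdiff.2 ⟨h, hk⟩)
      rw [smul_zero, add_zero, sub_eq_zero, hfT, hfy k hkA']
      split_ifs with hkG
      · have h1 := (memG k).1 hkG
        rw [hfy k hkA'] at h1
        have h2 : ‖b.f k x‖ = t := le_antisymm (hout k hk) h1
        rw [h2, div_self htpos.ne']
        simp
      · rfl
  · rw [sub_sub_cancel]
    have h1 := norm_add_le T (((2 * t : ℝ) : 𝕜) • D)
    rw [norm_smul, RCLike.norm_ofReal, abs_of_pos (by positivity)] at h1
    have h2 : 2 * t * ‖D‖ ≤ 2 * t * (Cs * ‖b.indic ε G‖) := by gcongr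
    have h3 : 2 * Cs * (t * ‖b.indic ε G‖) ≤ 2 * Cs * (2 * Cq * ‖y‖) := by gcongr
    nlinarith
end
end

section
/- Let B be a Schauder basis of a Banach space X over 𝔽. The following are equivalent: (a) B is semi-greedy (i.e., C-semi-greedy for some constant C); (b) B is quasi-greedy and super-democratic; (c) B is quasi-greedy and disjoint-super-democratic. -/
open scoped BigOperators NNReal

noncomputable section

namespace MBasis

section helpers

variable {𝕜 : Type*} [RCLike 𝕜] {X : Type*} [NormedAddCommGroup X] [NormedSpace 𝕜 X]

theorem f_sum (b : MBasis 𝕜 X) (A : Finset ℕ) (a : ℕ → 𝕜) (k : ℕ) :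
    b.f k (∑ n ∈ A, a n • b.e n) = if k ∈ A then a k else 0 := by
  simp [map_sum, b.biorth]

theorem f_proj (b : MBasis 𝕜 X) (A : Finset ℕ) (x : X) (k : ℕ) :
    b.f k (b.proj A x) = if k ∈ A then b.f k x else 0 := by
  unfold proj
  exact b.f_sum A (fun n => b.f n x) k

theorem f_indic (b : MBasis 𝕜 X) (A : Finset ℕ) (ε : ℕ → 𝕜) (k : ℕ) :
    b.f k (b.indic ε A) = if k ∈ A then ε k else 0 := b.f_sum A ε k

theorem ext_f (b : MBasis 𝕜 X) {x y : X} (h : ∀ k, b.f k x = b.f k y) : x = y := by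
  rw [← sub_eq_zero]
  apply b.total
  intro j
  rw [map_sub, h, sub_self]

theorem sum_mem_span (b : MBasis 𝕜 X) (A : Finset ℕ) (a : ℕ → 𝕜) :
    ∑ n ∈ A, a n • b.e n ∈ Submodule.span 𝕜 (b.e '' (A : Set ℕ)) :=
  Submodule.sum_mem _ fun n hn => Submodule.smul_mem _ _
    (Submodule.subset_span ⟨n, hn, rfl⟩)

theorem mem_span_of (b : MBasis 𝕜 X) (A : Finset ℕ) (z : X) (h : ∀ k, k ∉ A → b.f k z = 0) :
    z ∈ Submodule.span 𝕜 (b.e '' (A : Set ℕ)) := by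
  have : z = b.proj A z := by
    apply b.ext_f
    intro k
    rw [f_proj]
    split_ifs with hk
    · rfl
    · exact h k hk
  rw [this]
  exact b.sum_mem_span A _

theorem f_of_mem_span (b : MBasis 𝕜 X) (A : Set ℕ) (z : X)
    (hz : z ∈ Submodule.span 𝕜 (b.e '' A)) (k : ℕ) (hk : k ∉ A) : b.f k z = 0 := by
  have h : z ∈ closure (Submodule.span 𝕜 (b.e '' A) : Set X) := subset_closure hz
  rw [b.strong] at h
  exact h k hk

theorem c₂_pos (b : MBasis 𝕜 X) : 0 < b.c₂ :=
  lt_of_lt_of_le b.c₁_pos ((b.c₁_le_e 0).trans (b.e_le_c₂ 0))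

theorem finite_large (b : MBasis 𝕜 X) (x : X) (α : ℝ) (hα : 0 < α) :
    ∃ G : Finset ℕ, ∀ n, n ∈ G ↔ α ≤ ‖b.f n x‖ := by
  have hx : x ∈ closure (Submodule.span 𝕜 (Set.range b.e) : Set X) := by
    rw [b.dense_span]; trivial
  obtain ⟨y, hy, hd⟩ := Metric.mem_closure_iff.1 hx (α / b.c₂) (div_pos hα b.c₂_pos)
  obtain ⟨c, rfl⟩ := (Finsupp.mem_span_range_iff_exists_finsupp).1 hy
  have hfin : {n | α ≤ ‖b.f n x‖}.Finite := by
    apply c.support.finite_toSet.subset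
    intro n hn
    by_contra hns
    have h0 : b.f n (c.sum fun i a => a • b.e i) = 0 := by
      rw [Finsupp.sum, b.f_sum, if_neg (fun h => hns (Finset.mem_coe.2 h))]
    have h1 : ‖b.f n x‖ < α := by
      calc ‖b.f n x‖ = ‖b.f n (x - c.sum fun i a => a • b.e i)‖ := by rw [map_sub, h0, sub_zero]
        _ ≤ ‖b.f n‖ * ‖x - c.sum fun i a => a • b.e i‖ := (b.f n).le_opNorm _
        _ ≤ b.c₂ * ‖x - c.sum fun i a => a • b.e i‖ := by
          gcongr; exact b.f_le_c₂ n
        _ < b.c₂ * (α / b.c₂) := by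
          rw [← dist_eq_norm]
          exact mul_lt_mul_of_pos_left hd b.c₂_pos
        _ = α := by field_simp [b.c₂_pos.ne']
    exact absurd hn (not_le.2 h1)
  exact ⟨hfin.toFinset, fun n => by simp⟩

theorem exists_level (b : MBasis 𝕜 X) (x : X) (Λ : Finset ℕ) (h : b.IsGreedySet x Λ)
    (hne : Λ.Nonempty) : ∃ α : ℝ, 0 ≤ α ∧ (∀ n ∈ Λ, α ≤ ‖b.f n x‖) ∧
      ∀ k, k ∉ Λ → ‖b.f k x‖ ≤ α := by
  obtain ⟨n, hn, hmin⟩ := Λ.exists_min_image (fun n => ‖b.f n x‖) hne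
  exact ⟨‖b.f n x‖, norm_nonneg _, hmin, fun k hk => h n hn k hk⟩

/-- Abel summation along greedy sets. -/
theorem abel_sum (b : MBasis 𝕜 X) {C : ℝ} (hq : b.QuasiGreedy C) (x : X) (w : ℕ → ℝ)
    (hw0 : ∀ n, 0 ≤ w n) :
    ∀ (N : ℕ) (G : Finset ℕ), G.card = N → b.IsGreedySet x G →
      (∀ m ∈ G, ∀ n ∈ G, ‖b.f n x‖ ≤ ‖b.f m x‖ → w m ≤ w n) →
      ∀ t : ℝ, 0 ≤ t → (∀ n ∈ G, w n ≤ t) →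
      ‖∑ n ∈ G, ((w n : 𝕜) * b.f n x) • b.e n - (t : 𝕜) • b.proj G x‖ ≤
        t * ((1 + C) * ‖x‖) := by
  have hP : ∀ G, b.IsGreedySet x G → ‖b.proj G x‖ ≤ (1 + C) * ‖x‖ := by
    intro G hG
    have h1 := hq x G hG
    have h2 : ‖b.proj G x‖ ≤ ‖x‖ + ‖x - b.proj G x‖ := by
      have := norm_sub_le x (x - b.proj G x)
      rwa [sub_sub_cancel] at this
    linarith
  intro N
  induction N with
  | zero =>
    intro G hc hG _ t ht _
    rw [Finset.card_eq_zero] at hc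
    subst hc
    have := hP ∅ hG
    have h0 : 0 ≤ (1 + C) * ‖x‖ := (norm_nonneg _).trans this
    simp only [proj, Finset.sum_empty, smul_zero, sub_zero, norm_zero]
    positivity
  | succ N ih =>
    intro G hc hG hw t ht hwt
    have hne : G.Nonempty := by
      rw [← Finset.card_pos]; omega
    obtain ⟨n, hn, hmin⟩ := G.exists_min_image (fun n => ‖b.f n x‖) hne
    have hG' : b.IsGreedySet x (G.erase n) := by
      intro m hm k hk
      by_cases hkn : k = n
      · subst hkn; exact hmin m (Finset.mem_of_mem_erase hm)
      · exact hG m (Finset.mem_of_mem_erase hm) k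
          (fun h => hk (Finset.mem_erase.2 ⟨hkn, h⟩))
    have h1 := ih (G.erase n) (by rw [Finset.card_erase_of_mem hn]; omega) hG'
      (fun m hm k hk => hw m (Finset.mem_of_mem_erase hm) k (Finset.mem_of_mem_erase hk))
      (w n) (hw0 n)
      (fun m hm => hw m (Finset.mem_of_mem_erase hm) n hn (hmin m (Finset.mem_of_mem_erase hm)))
    have hsum := Finset.add_sum_erase G (fun n => ((w n : 𝕜) * b.f n x) • b.e n) hn
    have hproj : b.f n x • b.e n + b.proj (G.erase n) x = b.proj G x :=
      Finset.add_sum_erase G (fun n => b.f n x • b.e n) hn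
    have key : ∑ n ∈ G, ((w n : 𝕜) * b.f n x) • b.e n - (t : 𝕜) • b.proj G x
        = (∑ k ∈ G.erase n, ((w k : 𝕜) * b.f k x) • b.e k - (w n : 𝕜) • b.proj (G.erase n) x)
          - ((t - w n : ℝ) : 𝕜) • b.proj G x := by
      rw [← hsum, ← hproj]
      push_cast
      module
    rw [key]
    have h2 : ‖((t - w n : ℝ) : 𝕜) • b.proj G x‖ ≤ (t - w n) * ((1 + C) * ‖x‖) := by
      have h3 : 0 ≤ t - w n := sub_nonneg.2 (hwt n hn)
      rw [norm_smul, RCLike.norm_ofReal, abs_of_nonneg h3]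
      exact mul_le_mul_of_nonneg_left (hP G hG) h3
    calc _ ≤ _ := norm_sub_le _ _
      _ ≤ w n * ((1 + C) * ‖x‖) + (t - w n) * ((1 + C) * ‖x‖) := add_le_add h1 h2
      _ = _ := by ring

/-- the sign of the coefficients -/
def sgnOf (b : MBasis 𝕜 X) (x : X) (n : ℕ) : 𝕜 :=
  if b.f n x = 0 then 1 else ((‖b.f n x‖⁻¹ : ℝ) : 𝕜) * b.f n x

theorem sgnOf_sign (b : MBasis 𝕜 X) (x : X) : IsSign (b.sgnOf x) := by
  intro n
  unfold sgnOf
  split_ifs with h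
  · simp
  · rw [norm_mul, RCLike.norm_ofReal, abs_of_nonneg (by positivity),
      inv_mul_cancel₀ (norm_ne_zero_iff.2 h)]

theorem indic_bound (b : MBasis 𝕜 X) {C : ℝ} (hq : b.QuasiGreedy C) (x : X) (G : Finset ℕ)
    (hG : b.IsGreedySet x G) (α : ℝ) (hα : 0 < α) (h : ∀ n ∈ G, α ≤ ‖b.f n x‖) :
    α * ‖b.indic (b.sgnOf x) G‖ ≤ 2 * (1 + C) * ‖x‖ := by
  have h1 := b.abel_sum hq x (fun n => α / ‖b.f n x‖) (fun n => by positivity) _ G rfl hG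
    (fun m hm n hn hmn => by
      have : 0 < ‖b.f n x‖ := lt_of_lt_of_le hα (h n hn)
      gcongr) 1 zero_le_one (fun n hn => by
      have : 0 < ‖b.f n x‖ := lt_of_lt_of_le hα (h n hn)
      rw [div_le_one this]; exact h n hn)
  have h2 : ∑ n ∈ G, (((α / ‖b.f n x‖ : ℝ) : 𝕜) * b.f n x) • b.e n
      = (α : 𝕜) • b.indic (b.sgnOf x) G := by
    unfold indic
    rw [Finset.smul_sum]
    apply Finset.sum_congr rfl
    intro n hn
    have : b.f n x ≠ 0 := norm_pos_iff.1 (lt_of_lt_of_le hα (h n hn))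
    rw [smul_smul, sgnOf, if_neg this, div_eq_mul_inv]
    push_cast
    rw [mul_assoc]
  rw [h2] at h1
  have h3 : ‖b.proj G x‖ ≤ (1 + C) * ‖x‖ := by
    have h1 := hq x G hG
    have h2 : ‖b.proj G x‖ ≤ ‖x‖ + ‖x - b.proj G x‖ := by
      have := norm_sub_le x (x - b.proj G x)
      rwa [sub_sub_cancel] at this
    linarith
  have h4 : α * ‖b.indic (b.sgnOf x) G‖ = ‖(α : 𝕜) • b.indic (b.sgnOf x) G‖ := by
    rw [norm_smul, RCLike.norm_ofReal, abs_of_pos hα]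
  rw [h4]
  have h5 := norm_add_le ((α : 𝕜) • b.indic (b.sgnOf x) G - ((1 : ℝ) : 𝕜) • b.proj G x)
    (b.proj G x)
  rw [RCLike.ofReal_one, one_smul, sub_add_cancel] at h5
  rw [RCLike.ofReal_one, one_smul] at h1
  linarith

theorem unit_decomp (a : 𝕜) (ha : ‖a‖ ≤ 1) : ∃ (u : 𝕜) (s t : ℝ), ‖u‖ = 1 ∧ 0 ≤ s ∧ 0 ≤ t ∧
    s + t = 1 ∧ a = (s : 𝕜) * u + (t : 𝕜) * (-u) := by
  by_cases h : a = 0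
  · exact ⟨1, 1/2, 1/2, by simp, by norm_num, by norm_num, by norm_num, by rw [h]; ring⟩
  · have hn : ‖a‖ ≠ 0 := norm_ne_zero_iff.2 h
    refine ⟨((‖a‖⁻¹ : ℝ) : 𝕜) * a, (1 + ‖a‖)/2, (1 - ‖a‖)/2, ?_, by positivity, by linarith,
      by ring, ?_⟩
    · rw [norm_mul, RCLike.norm_ofReal, abs_of_nonneg (by positivity), inv_mul_cancel₀ hn]
    · have hn' : (‖a‖ : 𝕜) ≠ 0 := by exact_mod_cast hn
      push_cast
      field_simp
      ring

theorem convex_bound (b : MBasis 𝕜 X) (M : ℝ) (A : Finset ℕ) : ∀ (y : X),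
    (∀ ε : ℕ → 𝕜, IsSign ε → ‖y + b.indic ε A‖ ≤ M) →
    ∀ a : ℕ → 𝕜, (∀ n ∈ A, ‖a n‖ ≤ 1) → ‖y + ∑ n ∈ A, a n • b.e n‖ ≤ M := by
  induction A using Finset.induction_on with
  | empty =>
    intro y h a _
    simpa [indic] using h (fun _ => 1) (fun _ => by simp)
  | insert k A hk ih =>
    intro y h a ha
    have hu : ∀ u : 𝕜, ‖u‖ = 1 → ‖(y + u • b.e k) + ∑ n ∈ A, a n • b.e n‖ ≤ M := by
      intro u hu
      apply ih
      · intro ε hε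
        have h1 := h (Function.update ε k u) (by
          intro n
          by_cases hn : n = k
          · subst hn; simpa using hu
          · simpa [hn] using hε n)
        unfold indic at h1 ⊢
        rw [Finset.sum_insert hk, Function.update_self] at h1
        rw [add_assoc]
        convert h1 using 4
        apply Finset.sum_congr rfl
        intro n hn
        have : n ≠ k := by rintro rfl; exact hk hn
        simp [this]
      · intro n hn
        exact ha n (Finset.mem_insert_of_mem hn)
    obtain ⟨u, s, t, hu1, hs, ht, hst, hau⟩ := unit_decomp (a k) (ha k (Finset.mem_insert_self _ _))
    rw [Finset.sum_insert hk]
    have hst' : (s : 𝕜) + (t : 𝕜) = 1 := by exact_mod_cast hst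
    have key : y + (a k • b.e k + ∑ n ∈ A, a n • b.e n) =
        (s : 𝕜) • ((y + u • b.e k) + ∑ n ∈ A, a n • b.e n) +
        (t : 𝕜) • ((y + (-u) • b.e k) + ∑ n ∈ A, a n • b.e n) := by
      have ht' : (t : 𝕜) = 1 - s := by rw [← hst']; ring
      rw [hau, ht']
      module
    rw [key]
    calc _ ≤ _ := norm_add_le _ _
      _ = s * ‖(y + u • b.e k) + ∑ n ∈ A, a n • b.e n‖ +
          t * ‖(y + (-u) • b.e k) + ∑ n ∈ A, a n • b.e n‖ := by
        rw [norm_smul, norm_smul, RCLike.norm_ofReal, RCLike.norm_ofReal, abs_of_nonneg hs,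
          abs_of_nonneg ht]
      _ ≤ s * M + t * M := by
        gcongr
        · exact hu u hu1
        · exact hu (-u) (by rw [norm_neg, hu1])
      _ = M := by rw [← add_mul, hst, one_mul]

theorem super_of_disj (b : MBasis 𝕜 X) {C : ℝ} (h : b.DisjSuperDemocratic C) :
    ∃ C' : ℝ, 0 ≤ C' ∧ b.SuperDemocratic C' := by
  have h' : b.DisjSuperDemocratic (max C 0) := by
    intro A B hd hc ε ε' hε hε'
    exact (h A B hd hc ε ε' hε hε').trans (by gcongr; exact le_max_left _ _)
  refine ⟨max C 0 * max C 0, by positivity, ?_⟩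
  intro A B hc ε ε' hε hε'
  obtain ⟨N, hN⟩ : ∃ N, ∀ n ∈ A ∪ B, n < N :=
    ⟨(A ∪ B).sup id + 1, fun n hn => Nat.lt_succ_of_le (Finset.le_sup (f := id) hn)⟩
  have hD : ∀ S, S ⊆ A ∪ B → Disjoint S (Finset.Ico N (N + B.card)) := by
    intro S hS
    rw [Finset.disjoint_left]
    intro n hn hn'
    have := hN n (hS hn)
    have := Finset.mem_Ico.1 hn'
    omega
  have h1 := h' A (Finset.Ico N (N + B.card)) (hD A Finset.subset_union_left) (by simpa using hc)
    ε (fun _ => 1) hε (fun _ => by simp)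
  have h2 := h' (Finset.Ico N (N + B.card)) B (hD B Finset.subset_union_right).symm (by simp)
    (fun _ => 1) ε' (fun _ => by simp) hε'
  calc _ ≤ _ := h1
    _ ≤ _ := mul_le_mul_of_nonneg_left h2 (by positivity)
    _ = _ := by ring

theorem semi_of_quasi (b : MBasis 𝕜 X) {Q S : ℝ} (hQ0 : 0 ≤ Q) (hS0 : 0 ≤ S)
    (hq : b.QuasiGreedy Q) (hs : b.SuperDemocratic S) :
    b.SemiGreedy (2 * (1 + Q) + Q + 2 * (S * (2 * (1 + Q))) + 1) := by
  intro x Λ hΛ A hA a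
  by_cases hne : Λ.Nonempty
  swap
  · rw [Finset.not_nonempty_iff_eq_empty] at hne
    subst hne
    have : A = ∅ := by simpa using hA
    subst this
    refine ⟨0, Submodule.zero_mem _, ?_⟩
    simp only [Finset.sum_empty, sub_zero]
    have : 0 ≤ (2 * (1 + Q) + Q + 2 * (S * (2 * (1 + Q)))) * ‖x‖ := by positivity
    linarith
  obtain ⟨α, hα0, hαΛ, hαc⟩ := b.exists_level x Λ hΛ hne
  rcases hα0.eq_or_lt with rfl | hα
  · refine ⟨x, b.mem_span_of Λ x fun k hk => norm_le_zero_iff.1 (hαc k hk), ?_⟩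
    rw [sub_self, norm_zero]
    positivity
  set v := x - ∑ n ∈ A, a n • b.e n with hv
  have hvf : ∀ k, k ∉ A → b.f k v = b.f k x := by
    intro k hk
    rw [hv, map_sub, f_sum, if_neg hk, sub_zero]
  obtain ⟨G, hG⟩ := b.finite_large v α hα
  have hGg : b.IsGreedySet v G := by
    intro n hn k hk
    rw [hG] at hn hk
    linarith
  have hb := b.indic_bound hq v G hGg α hα (fun n hn => (hG n).1 hn)
  set T := (α : 𝕜) • b.indic (b.sgnOf v) G + (v - b.proj G v) with hT
  have hTf : ∀ k, b.f k T = if k ∈ G then (α : 𝕜) * b.sgnOf v k else b.f k v := by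
    intro k
    rw [hT, map_add, map_smul, map_sub, f_indic, f_proj]
    split_ifs <;> simp
  have hTn : ∀ k, ‖b.f k T‖ ≤ α := by
    intro k
    rw [hTf]
    split_ifs with h
    · rw [norm_mul, b.sgnOf_sign v k, RCLike.norm_ofReal, abs_of_pos hα, mul_one]
    · rw [hG] at h; linarith
  have hTnorm : ‖T‖ ≤ (2 * (1 + Q) + Q) * ‖v‖ := by
    have h1 := hq v G hGg
    have h2 : ‖(α : 𝕜) • b.indic (b.sgnOf v) G‖ ≤ 2 * (1 + Q) * ‖v‖ := by
      rw [norm_smul, RCLike.norm_ofReal, abs_of_pos hα]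
      exact hb
    have := norm_add_le ((α : 𝕜) • b.indic (b.sgnOf v) G) (v - b.proj G v)
    linarith
  set D := A \ Λ with hD
  have hDc : D.card ≤ G.card := by
    have h1 : (Λ \ A) ⊆ G := by
      intro n hn
      rw [Finset.mem_sdiff] at hn
      rw [hG, hvf n hn.2]
      exact hαΛ n hn.1
    exact ((Finset.card_sdiff_le_card_sdiff_iff).2 hA).trans (Finset.card_le_card h1)
  set W := ∑ n ∈ D, (b.f n x - b.f n T) • b.e n with hW
  have hWnorm : ‖W‖ ≤ 2 * (S * (2 * (1 + Q))) * ‖v‖ := by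
    have h1 := b.convex_bound (S * ‖b.indic (b.sgnOf v) G‖) D 0
      (fun ε hε => by
        rw [zero_add]
        exact hs D G hDc ε _ hε (b.sgnOf_sign v))
      (fun n => ((2 * α : ℝ) : 𝕜)⁻¹ * (b.f n x - b.f n T))
      (fun n hn => by
        rw [norm_mul, norm_inv, RCLike.norm_ofReal, abs_of_pos (by positivity)]
        rw [inv_mul_le_iff₀ (by positivity), mul_one]
        have h2 := hαc n (Finset.mem_sdiff.1 hn).2
        have h3 := hTn n
        have := norm_sub_le (b.f n x) (b.f n T)
        linarith)
    have h2 : W = ((2 * α : ℝ) : 𝕜) •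
        (0 + ∑ n ∈ D, (((2 * α : ℝ) : 𝕜)⁻¹ * (b.f n x - b.f n T)) • b.e n) := by
      rw [zero_add, Finset.smul_sum, hW]
      apply Finset.sum_congr rfl
      intro n _
      have : ((2 * α : ℝ) : 𝕜) ≠ 0 := by
        have : (2 * α : ℝ) ≠ 0 := by positivity
        exact_mod_cast this
      rw [smul_smul, mul_inv_cancel_left₀ this]
    rw [h2, norm_smul, RCLike.norm_ofReal, abs_of_pos (by positivity)]
    calc _ ≤ 2 * α * (S * ‖b.indic (b.sgnOf v) G‖) := by gcongr
      _ = 2 * S * (α * ‖b.indic (b.sgnOf v) G‖) := by ring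
      _ ≤ 2 * S * (2 * (1 + Q) * ‖v‖) := by gcongr
      _ = _ := by ring
  refine ⟨x - (T + W), b.mem_span_of Λ _ ?_, ?_⟩
  · intro k hk
    rw [map_sub, map_add, hW, b.f_sum D (fun n => b.f n x - b.f n T)]
    by_cases hkA : k ∈ A
    · rw [if_pos (Finset.mem_sdiff.2 ⟨hkA, hk⟩)]
      ring
    · rw [if_neg (fun h => hkA (Finset.mem_sdiff.1 h).1), hTf]
      split_ifs with hkG
      · have h1 := (hG k).1 hkG
        have h2 := hαc k hk
        rw [← hvf k hkA] at h2
        have h3 : ‖b.f k v‖ = α := le_antisymm h2 h1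
        have h4 : b.f k v ≠ 0 := by
          rw [← norm_pos_iff, h3]; exact hα
        have hα' : (α : 𝕜) ≠ 0 := by exact_mod_cast hα.ne'
        rw [sgnOf, if_neg h4, h3, ← hvf k hkA]
        push_cast
        rw [mul_inv_cancel_left₀ hα']
        ring
      · rw [hvf k hkA]; ring
  · rw [sub_sub_cancel]
    have := norm_add_le T W
    have := norm_nonneg v
    linarith

theorem interval_bound (b : MBasis 𝕜 X) {K : ℝ} (h : b.SchauderConst K) :
    ∃ L : ℝ, 0 ≤ L ∧ ∀ N m x, ‖b.proj (Finset.Ico N (N + m)) x‖ ≤ L * ‖x‖ := by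
  refine ⟨max (2 * K) 0, le_max_right _ _, ?_⟩
  intro N m x
  have h1 : b.proj (Finset.Ico N (N + m)) x = (∑ j ∈ Finset.range (N + m), b.f j x • b.e j)
      - ∑ j ∈ Finset.range N, b.f j x • b.e j :=
    Finset.sum_Ico_eq_sub _ (Nat.le_add_right _ _)
  rw [h1]
  calc _ ≤ _ := norm_sub_le _ _
    _ ≤ K * ‖x‖ + K * ‖x‖ := add_le_add (h _ _) (h _ _)
    _ = (2 * K) * ‖x‖ := by ring
    _ ≤ _ := by gcongr; exact le_max_left _ _

theorem sub_proj_bound (b : MBasis 𝕜 X) {L : ℝ} {D : Finset ℕ}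
    (h : ∀ x, ‖b.proj D x‖ ≤ L * ‖x‖) (x : X) : ‖x - b.proj D x‖ ≤ (1 + L) * ‖x‖ := by
  have := norm_sub_le x (b.proj D x)
  have := h x
  linarith

theorem semi_disj (b : MBasis 𝕜 X) {C L : ℝ} (hC : 0 ≤ C) (hL : 0 ≤ L)
    (hs : b.SemiGreedy C)
    (hI : ∀ N m x, ‖b.proj (Finset.Ico N (N + m)) x‖ ≤ L * ‖x‖) :
    b.SuperDemocratic ((1 + L) * C * (L * C)) := by
  intro A B hc ε ε' hε hε'
  obtain ⟨N, hN⟩ : ∃ N, ∀ n ∈ A ∪ B, n < N :=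
    ⟨(A ∪ B).sup id + 1, fun n hn => Nat.lt_succ_of_le (Finset.le_sup (f := id) hn)⟩
  set D := Finset.Ico N (N + B.card) with hD
  have hDcard : D.card = B.card := by simp [hD]
  have hdis : ∀ n, n ∈ A ∪ B → n ∉ D := by
    intro n hn hn'
    have := hN n hn
    have := Finset.mem_Ico.1 hn'
    omega
  have hA : ∀ n ∈ A, n ∉ D := fun n hn => hdis n (Finset.mem_union_left _ hn)
  have hB : ∀ n ∈ B, n ∉ D := fun n hn => hdis n (Finset.mem_union_right _ hn)
  have hPD := hI N B.card
  rw [← hD] at hPD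
  have h1 : ‖b.indic ε A‖ ≤ (1 + L) * C * ‖b.indic (fun _ => (1 : 𝕜)) D‖ := by
    obtain ⟨z, hz, hzn⟩ := hs (b.indic ε A + b.indic (fun _ => (1 : 𝕜)) D) D (by
      intro n hn k hk
      rw [map_add, map_add, f_indic, f_indic, f_indic, f_indic, if_pos hn, if_neg hk,
        if_neg (fun h => hA n h hn)]
      split_ifs
      · simp [hε k]
      · simp) A (by omega) ε
    have h2 := b.sub_proj_bound hPD (b.indic ε A + b.indic (fun _ => (1 : 𝕜)) D - z)
    have h3 : (b.indic ε A + b.indic (fun _ => (1 : 𝕜)) D - z) -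
        b.proj D (b.indic ε A + b.indic (fun _ => (1 : 𝕜)) D - z) = b.indic ε A := by
      apply b.ext_f
      intro k
      by_cases hk : k ∈ D
      · have : k ∉ A := fun h => hA k h hk
        simp [f_proj, f_indic, hk, this]
      · simp [f_proj, f_indic, hk, b.f_of_mem_span _ z hz k (by simpa using hk)]
    rw [h3] at h2
    have h4 : b.indic ε A + b.indic (fun _ => (1 : 𝕜)) D - ∑ n ∈ A, ε n • b.e n
        = b.indic (fun _ => (1 : 𝕜)) D := by
      unfold indic; abel
    rw [h4] at hzn
    calc _ ≤ _ := h2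
      _ ≤ (1 + L) * (C * ‖b.indic (fun _ => (1 : 𝕜)) D‖) := by gcongr
      _ = _ := by ring
  have h2 : ‖b.indic (fun _ => (1 : 𝕜)) D‖ ≤ L * C * ‖b.indic ε' B‖ := by
    obtain ⟨z, hz, hzn⟩ := hs (b.indic ε' B + b.indic (fun _ => (1 : 𝕜)) D) B (by
      intro n hn k hk
      rw [map_add, map_add, f_indic, f_indic, f_indic, f_indic, if_pos hn, if_neg hk,
        if_neg (hB n hn), add_zero, hε' n]
      split_ifs <;> simp) D (by omega) (fun _ => 1)
    have h2 := hPD (b.indic ε' B + b.indic (fun _ => (1 : 𝕜)) D - z)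
    have h3 : b.proj D (b.indic ε' B + b.indic (fun _ => (1 : 𝕜)) D - z)
        = b.indic (fun _ => (1 : 𝕜)) D := by
      apply b.ext_f
      intro k
      by_cases hk : k ∈ D
      · have : k ∉ B := fun h => hB k h hk
        simp [f_proj, f_indic, hk, this, b.f_of_mem_span _ z hz k (by simpa using this)]
      · simp [f_proj, f_indic, hk]
    rw [h3] at h2
    have h4 : b.indic ε' B + b.indic (fun _ => (1 : 𝕜)) D - ∑ n ∈ D, (1 : 𝕜) • b.e n
        = b.indic ε' B := by
      unfold indic; abel
    rw [h4] at hzn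
    calc _ ≤ _ := h2
      _ ≤ L * (C * ‖b.indic ε' B‖) := by gcongr
      _ = _ := by ring
  calc _ ≤ _ := h1
    _ ≤ (1 + L) * C * (L * C * ‖b.indic ε' B‖) := by gcongr
    _ = _ := by ring

theorem semi_quasi (b : MBasis 𝕜 X) {C L : ℝ} (hC : 0 ≤ C) (hL : 0 ≤ L)
    (hs : b.SemiGreedy C)
    (hI : ∀ N m x, ‖b.proj (Finset.Ico N (N + m)) x‖ ≤ L * ‖x‖) :
    b.QuasiGreedy ((1 + L) * (C * (1 + L + L * C)) + L + 1) := by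
  intro x Λ hΛ
  by_cases hne : Λ.Nonempty
  swap
  · rw [Finset.not_nonempty_iff_eq_empty] at hne
    subst hne
    simp only [proj, Finset.sum_empty, sub_zero]
    have : 0 ≤ ((1 + L) * (C * (1 + L + L * C)) + L) * ‖x‖ := by positivity
    linarith
  obtain ⟨α, hα0, hαΛ, hαc⟩ := b.exists_level x Λ hΛ hne
  obtain ⟨N, hN⟩ : ∃ N, ∀ n ∈ Λ, n < N :=
    ⟨Λ.sup id + 1, fun n hn => Nat.lt_succ_of_le (Finset.le_sup (f := id) hn)⟩
  set D := Finset.Ico N (N + Λ.card) with hD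
  have hDcard : D.card = Λ.card := by simp [hD]
  have hdis : ∀ n, n ∈ Λ → n ∉ D := by
    intro n hn hn'
    have := hN n hn
    have := Finset.mem_Ico.1 hn'
    omega
  have hPD := hI N Λ.card
  rw [← hD] at hPD
  have hαn : ‖(α : 𝕜)‖ = α := by rw [RCLike.norm_ofReal, abs_of_nonneg hα0]
  set E := ∑ n ∈ D, (α : 𝕜) • b.e n with hE
  have hEf : ∀ k, b.f k E = if k ∈ D then (α : 𝕜) else 0 := fun k => b.f_sum D (fun _ => (α : 𝕜)) k
  -- step 1
  have h1 : ‖E‖ ≤ L * C * ‖x‖ := by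
    obtain ⟨z, hz, hzn⟩ := hs (x + ∑ n ∈ D, ((α : 𝕜) - b.f n x) • b.e n) Λ (by
      intro n hn k hk
      rw [map_add, map_add, b.f_sum D (fun n => (α : 𝕜) - b.f n x),
        b.f_sum D (fun n => (α : 𝕜) - b.f n x), if_neg (hdis n hn), add_zero]
      refine le_trans ?_ (hαΛ n hn)
      split_ifs
      · rw [add_sub_cancel, hαn]
      · rw [add_zero]; exact hαc k hk) D (by omega) (fun n => (α : 𝕜) - b.f n x)
    rw [add_sub_cancel_right] at hzn
    have h2 := hPD (x + ∑ n ∈ D, ((α : 𝕜) - b.f n x) • b.e n - z)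
    have h3 : b.proj D (x + ∑ n ∈ D, ((α : 𝕜) - b.f n x) • b.e n - z) = E := by
      apply b.ext_f
      intro k
      rw [f_proj, hEf]
      split_ifs with hk
      · have : k ∉ Λ := fun h => hdis k h hk
        rw [map_sub, map_add, b.f_sum D (fun n => (α : 𝕜) - b.f n x), if_pos hk,
          b.f_of_mem_span _ z hz k (by simpa using this)]
        ring
      · rfl
    rw [h3] at h2
    calc _ ≤ _ := h2
      _ ≤ L * (C * ‖x‖) := by gcongr
      _ = _ := by ring
  -- step 2
  set u := x - b.proj Λ x + (E - b.proj D x) with hu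
  have huf : ∀ k, b.f k u = if k ∈ D then (α : 𝕜) else if k ∈ Λ then 0 else b.f k x := by
    intro k
    rw [hu, map_add, map_sub, map_sub, hEf, f_proj, f_proj]
    by_cases hk : k ∈ D
    · have : k ∉ Λ := fun h => hdis k h hk
      simp [hk, this]
    · by_cases hk' : k ∈ Λ <;> simp [hk, hk']
  obtain ⟨z, hz, hzn⟩ := hs u D (by
    intro n hn k hk
    rw [huf, huf, if_pos hn, if_neg hk, hαn]
    split_ifs with h
    · simpa using hα0
    · exact hαc k h) Λ (by omega) (fun n => - b.f n x)
  have h2 : u - ∑ n ∈ Λ, (- b.f n x) • b.e n = x + (E - b.proj D x) := by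
    simp only [neg_smul, Finset.sum_neg_distrib, hu]
    unfold proj
    abel
  rw [h2] at hzn
  have h3 : ‖x + (E - b.proj D x)‖ ≤ (1 + L + L * C) * ‖x‖ := by
    have := norm_add_le x (E - b.proj D x)
    have := norm_sub_le E (b.proj D x)
    have := hPD x
    linarith
  have h4 := b.sub_proj_bound hPD (u - z)
  have h5 : u - z - b.proj D (u - z) = x - b.proj Λ x - b.proj D x := by
    apply b.ext_f
    intro k
    rw [map_sub, f_proj, map_sub, huf, map_sub, map_sub, f_proj, f_proj]
    by_cases hk : k ∈ D
    · have : k ∉ Λ := fun h => hdis k h hk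
      simp [hk, this]
    · by_cases hk' : k ∈ Λ <;>
        simp [hk, hk', b.f_of_mem_span _ z hz k (by simpa using hk)]
  rw [h5] at h4
  have h6 : ‖u - z‖ ≤ C * ((1 + L + L * C) * ‖x‖) := hzn.trans (by gcongr)
  have h7 : (1 + L) * ‖u - z‖ ≤ (1 + L) * (C * ((1 + L + L * C) * ‖x‖)) := by gcongr
  have h8 := norm_add_le (x - b.proj Λ x - b.proj D x) (b.proj D x)
  rw [sub_add_cancel] at h8
  have h9 := hPD x
  have := norm_nonneg x
  linarith

theorem main_fwd (b : MBasis 𝕜 X) (hSch : ∃ K : ℝ, b.SchauderConst K)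
    (h : ∃ C : ℝ, b.SemiGreedy C) :
    (∃ C : ℝ, b.QuasiGreedy C) ∧ (∃ C : ℝ, b.SuperDemocratic C) := by
  obtain ⟨K, hK⟩ := hSch
  obtain ⟨C, hC⟩ := h
  obtain ⟨L, hL, hI⟩ := b.interval_bound hK
  have hC' : b.SemiGreedy (max C 0) := by
    intro x Λ hΛ A hA a
    obtain ⟨z, hz, h⟩ := hC x Λ hΛ A hA a
    exact ⟨z, hz, h.trans (by gcongr; exact le_max_left _ _)⟩
  exact ⟨⟨_, b.semi_quasi (le_max_right _ _) hL hC' hI⟩,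
    ⟨_, b.semi_disj (le_max_right _ _) hL hC' hI⟩⟩

theorem main_bwd (b : MBasis 𝕜 X) (h : ∃ C : ℝ, b.QuasiGreedy C)
    (h' : ∃ C : ℝ, b.DisjSuperDemocratic C) : ∃ C : ℝ, b.SemiGreedy C := by
  obtain ⟨Q, hQ⟩ := h
  obtain ⟨S, hS⟩ := h'
  obtain ⟨S', hS0, hS'⟩ := b.super_of_disj hS
  have hQ' : b.QuasiGreedy (max Q 0) := by
    intro x Λ hΛ
    exact (hQ x Λ hΛ).trans (by gcongr; exact le_max_left _ _)
  exact ⟨_, b.semi_of_quasi (le_max_right _ _) hS0 hQ' hS'⟩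

theorem disj_of_super (b : MBasis 𝕜 X) (h : ∃ C : ℝ, b.SuperDemocratic C) :
    ∃ C : ℝ, b.DisjSuperDemocratic C := by
  obtain ⟨C, hC⟩ := h
  exact ⟨C, fun A B _ => hC A B⟩

end helpers

end MBasis

variable {𝕜 : Type*} [RCLike 𝕜] {X : Type*} [NormedAddCommGroup X] [NormedSpace 𝕜 X]
  [CompleteSpace X]

open MBasis

/-- For a Schauder basis the following are equivalent: semi-greedy;
quasi-greedy and super-democratic; quasi-greedy and disjoint-super-democratic. -/
theorem stmt5 (b : MBasis 𝕜 X) (hSch : ∃ K : ℝ, b.SchauderConst K) :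
    ((∃ C : ℝ, b.SemiGreedy C) ↔
      ((∃ C : ℝ, b.QuasiGreedy C) ∧ (∃ C : ℝ, b.SuperDemocratic C))) ∧
    ((∃ C : ℝ, b.SemiGreedy C) ↔
      ((∃ C : ℝ, b.QuasiGreedy C) ∧ (∃ C : ℝ, b.DisjSuperDemocratic C))) := by
  refine ⟨⟨fun h => b.main_fwd hSch h, fun h => b.main_bwd h.1 (b.disj_of_super h.2)⟩,
    ⟨fun h => ⟨(b.main_fwd hSch h).1, b.disj_of_super (b.main_fwd hSch h).2⟩,
      fun h => b.main_bwd h.1 h.2⟩⟩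
end
end
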